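/- Asymptotically almost surely, m_R = m_A = m_Z; that is, with probability tending to 1 as n → ∞, the first time m in the random digraph process at which D(n,m) has at most one vertex of in-degree zero coincides with the first time D(n,m) contains a spanning arborescence, and also with the first time D(n,m) contains a rainbow spanning arborescence. -/

import Mathlib

open Filter

/-- The directed edges of the complete digraph on `Fin n`:
ordered pairs `(tail, head)` of distinct vertices. -/
abbrev DEdge (n : ℕ) := {e : Fin n × Fin n // e.1 ≠ e.2}

/-- `ε(n) = log log n / log n`. -/
noncomputable def eps (n : ℕ) : ℝ := Real.log (Real.log n) / Real.log n

/-- The number of available colours: `⌊(1 + 50 ε) n⌋`. -/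
noncomputable def numColours (n : ℕ) : ℕ := ⌊(1 + 50 * eps n) * n⌋₊

/-- The set of colours `W`. -/
abbrev Colour (n : ℕ) := Fin (numColours n)

/-- The sample space of the coloured random digraph process: a uniformly random
permutation of the edges (determining the random ordering `e₁, …, e_N`) together
with a uniformly random colouring of the edges. -/
abbrev SampleSpace (n : ℕ) := Equiv.Perm (DEdge n) × (DEdge n → Colour n)

/-- The (0-indexed) position of edge `e` in the random ordering determined by `ω`. -/
noncomputable def edgePos {n : ℕ} (ω : SampleSpace n) (e : DEdge n) : ℕ :=
  ((Fintype.equivFin (DEdge n)) (ω.1 e)).val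

/-- `e` is one of the first `m` edges of the process, i.e. an edge of `D(n,m)`. -/
def inProcess {n : ℕ} (ω : SampleSpace n) (m : ℕ) (e : DEdge n) : Prop :=
  edgePos ω e < m

/-- The probability of an event under the uniform measure on a finite sample space. -/
noncomputable def prob {Ω : Type*} [Fintype Ω] (p : Ω → Prop) : ℝ :=
  (Nat.card {ω : Ω // p ω} : ℝ) / (Fintype.card Ω : ℝ)

/-- Vertex `v` has in-degree zero in `D(n,m)`. -/
def InDegreeZero {n : ℕ} (ω : SampleSpace n) (m : ℕ) (v : Fin n) : Prop :=
  ∀ e : DEdge n, inProcess ω m e → e.val.2 ≠ v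

/-- The event `Z_m`: at most one vertex of `D(n,m)` has in-degree zero. -/
def ZEvent {n : ℕ} (ω : SampleSpace n) (m : ℕ) : Prop :=
  Set.Subsingleton {v : Fin n | InDegreeZero ω m v}

/-- `A` is the edge set of a spanning arborescence rooted at `u`: the root has no
in-edge, every other vertex has exactly one in-edge, and every vertex is reachable
from the root along edges of `A` (equivalently, for every vertex `v` there is
exactly one directed path from `u` to `v`). -/
def IsSpanningArborescence {n : ℕ} (A : Set (DEdge n)) (u : Fin n) : Prop :=
  (∀ e ∈ A, (e : DEdge n).val.2 ≠ u) ∧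
  (∀ v : Fin n, v ≠ u → ∃! e : DEdge n, e ∈ A ∧ e.val.2 = v) ∧
  (∀ v : Fin n, Relation.ReflTransGen (fun x y => ∃ e ∈ A, (e : DEdge n).val = (x, y)) u v)

/-- The event `A_m`: `D(n,m)` contains a spanning arborescence. -/
def AEvent {n : ℕ} (ω : SampleSpace n) (m : ℕ) : Prop :=
  ∃ (u : Fin n) (A : Set (DEdge n)), (∀ e ∈ A, inProcess ω m e) ∧ IsSpanningArborescence A u

/-- The event `R_m`: `D(n,m)` contains a rainbow spanning arborescence. -/
def REvent {n : ℕ} (ω : SampleSpace n) (m : ℕ) : Prop :=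
  ∃ (u : Fin n) (A : Set (DEdge n)), (∀ e ∈ A, inProcess ω m e) ∧
    IsSpanningArborescence A u ∧ Set.InjOn ω.2 A

/-- The hitting time `min {m : P m}`, with the convention `min ∅ = N = n(n-1)`. -/
noncomputable def hitTime (n : ℕ) (P : ℕ → Prop) : ℕ :=
  sInf ({m | P m} ∪ {n * (n - 1)})

section Prob

open Finset Function
open scoped Classical BigOperators

set_option linter.unusedSectionVars false

variable {Ω Ω' : Type*} [Fintype Ω] [Fintype Ω']

/-- The indicator of a proposition, as a real number. -/
noncomputable def ind (p : Prop) : ℝ := if p then 1 else 0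

lemma ind_nonneg (p : Prop) : 0 ≤ ind p := by unfold ind; split_ifs <;> norm_num

lemma ind_le_one (p : Prop) : ind p ≤ 1 := by unfold ind; split_ifs <;> norm_num

lemma ind_of_true {p : Prop} (h : p) : ind p = 1 := if_pos h

lemma ind_of_false {p : Prop} (h : ¬ p) : ind p = 0 := if_neg h

lemma ind_mono {p q : Prop} (h : p → q) : ind p ≤ ind q := by
  by_cases hp : p
  · rw [ind_of_true hp, ind_of_true (h hp)]
  · rw [ind_of_false hp]; exact ind_nonneg q

lemma ind_and (p q : Prop) : ind (p ∧ q) = ind p * ind q := by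
  unfold ind; split_ifs <;> simp_all

lemma ind_not (p : Prop) : ind (¬ p) = 1 - ind p := by
  unfold ind; split_ifs <;> simp_all

lemma ind_forall_mem {ι : Type*} (s : Finset ι) (p : ι → Prop) :
    ind (∀ i ∈ s, p i) = ∏ i ∈ s, ind (p i) := by
  by_cases h : ∀ i ∈ s, p i
  · rw [ind_of_true h, Finset.prod_eq_one fun i hi => ind_of_true (h i hi)]
  · rw [ind_of_false h]
    push Not at h
    obtain ⟨i, hi, hpi⟩ := h
    exact (Finset.prod_eq_zero hi (ind_of_false hpi)).symm

lemma prob_eq_expect (p : Ω → Prop) : prob p = 𝔼 ω, ind (p ω) := by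
  rw [Fintype.expect_eq_sum_div_card, prob]
  congr 1
  simp [ind, Nat.card_eq_fintype_card, Fintype.card_subtype]

lemma prob_nonneg (p : Ω → Prop) : 0 ≤ prob p := by unfold prob; positivity

lemma prob_mono {p q : Ω → Prop} (h : ∀ ω, p ω → q ω) : prob p ≤ prob q := by
  rw [prob_eq_expect, prob_eq_expect]
  exact Finset.expect_le_expect fun ω _ => ind_mono (h ω)

lemma prob_congr {p q : Ω → Prop} (h : ∀ ω, p ω ↔ q ω) : prob p = prob q :=
  le_antisymm (prob_mono fun ω => (h ω).1) (prob_mono fun ω => (h ω).2)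

lemma prob_true [Nonempty Ω] : prob (fun _ : Ω => True) = 1 := by
  rw [prob_eq_expect]; simp [ind]

lemma prob_le_one (p : Ω → Prop) : prob p ≤ 1 := by
  rw [prob_eq_expect, Fintype.expect_eq_sum_div_card]
  refine div_le_one_of_le₀ ?_ (by positivity)
  calc ∑ ω, ind (p ω) ≤ ∑ _ω : Ω, (1 : ℝ) := Finset.sum_le_sum fun ω _ => ind_le_one _
    _ = _ := by simp

lemma prob_not [Nonempty Ω] (p : Ω → Prop) : prob (fun ω => ¬ p ω) = 1 - prob p := by
  rw [prob_eq_expect, prob_eq_expect]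
  simp_rw [ind_not]
  rw [Finset.expect_sub_distrib, Fintype.expect_const]

lemma prob_or_le (p q : Ω → Prop) : prob (fun ω => p ω ∨ q ω) ≤ prob p + prob q := by
  simp_rw [prob_eq_expect]
  rw [← Finset.expect_add_distrib]
  refine Finset.expect_le_expect fun ω _ => ?_
  by_cases hp : p ω
  · rw [ind_of_true (Or.inl hp), ind_of_true hp]; linarith [ind_nonneg (q ω)]
  · rw [ind_of_false hp, zero_add]; exact ind_mono (by tauto)

lemma prob_exists_le {ι : Type*} (s : Finset ι) (p : ι → Ω → Prop) :
    prob (fun ω => ∃ i ∈ s, p i ω) ≤ ∑ i ∈ s, prob (p i) := by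
  simp_rw [prob_eq_expect]
  rw [← Finset.expect_sum_comm]
  refine Finset.expect_le_expect fun ω _ => ?_
  by_cases h : ∃ i ∈ s, p i ω
  · obtain ⟨i, hi, hp⟩ := h
    calc _ ≤ (1 : ℝ) := ind_le_one _
      _ = ind (p i ω) := (ind_of_true hp).symm
      _ ≤ _ := Finset.single_le_sum (f := fun i => ind (p i ω)) (fun i _ => ind_nonneg _) hi
  · rw [ind_of_false h]; exact Finset.sum_nonneg fun i _ => ind_nonneg _

lemma prob_equiv (e : Ω ≃ Ω') (p : Ω' → Prop) : prob (fun ω => p (e ω)) = prob p := by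
  rw [prob_eq_expect, prob_eq_expect]
  exact Fintype.expect_equiv e _ _ fun _ => rfl

lemma expect_prod (f : Ω × Ω' → ℝ) : 𝔼 x, f x = 𝔼 a, 𝔼 b, f (a, b) := by
  rw [← Finset.expect_product, Finset.univ_product_univ]

lemma prob_prod (p : Ω × Ω' → Prop) :
    prob p = 𝔼 a, prob (fun b => p (a, b)) := by
  simp_rw [prob_eq_expect]
  exact expect_prod _

lemma expect_le_of_forall_le {f : Ω → ℝ} {δ : ℝ} (hδ : 0 ≤ δ) (h : ∀ ω, f ω ≤ δ) :
    𝔼 ω, f ω ≤ δ := by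
  cases isEmpty_or_nonempty Ω
  · simpa using hδ
  · exact Finset.expect_le univ_nonempty fun ω _ => h ω

lemma prob_prod_le {p : Ω × Ω' → Prop} {δ : ℝ} (hδ : 0 ≤ δ)
    (h : ∀ a, prob (fun b => p (a, b)) ≤ δ) : prob p ≤ δ := by
  rw [prob_prod]
  exact expect_le_of_forall_le hδ h

lemma prob_prod_le' {p : Ω × Ω' → Prop} {δ : ℝ} (hδ : 0 ≤ δ)
    (h : ∀ b, prob (fun a => p (a, b)) ≤ δ) : prob p ≤ δ := by
  rw [← prob_equiv (Equiv.prodComm Ω' Ω) p]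
  exact prob_prod_le hδ h

lemma prob_prod_fst [Nonempty Ω'] (p : Ω → Prop) :
    prob (fun x : Ω × Ω' => p x.1) = prob p := by
  rw [prob_prod, prob_eq_expect]
  refine Finset.expect_congr rfl fun a _ => ?_
  rw [prob_eq_expect]
  exact Fintype.expect_const (ι := Ω') (ind (p a))

/-- If `E` is a bijection of `Ω × Γ` and for every `ω` the event `p`, evaluated at the first
component of `E (ω, ·)`, has probability at most `δ`, then so has `p`. -/
lemma prob_le_of_resample {Γ : Type*} [Fintype Γ] [Nonempty Γ] (E : Ω × Γ ≃ Ω × Γ)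
    {p : Ω → Prop} {δ : ℝ} (hδ : 0 ≤ δ)
    (h : ∀ ω, prob (fun γ => p (E (ω, γ)).1) ≤ δ) : prob p ≤ δ := by
  rw [← prob_prod_fst (Ω' := Γ) p, ← prob_equiv E]
  exact prob_prod_le hδ h

lemma expect_pi {ι : Type*} [Fintype ι] [DecidableEq ι] {κ : ι → Type*} [∀ i, Fintype (κ i)]
    (g : ∀ i, κ i → ℝ) : 𝔼 f : ∀ i, κ i, ∏ i, g i (f i) = ∏ i, 𝔼 x, g i x := by
  simp_rw [Fintype.expect_eq_sum_div_card]
  rw [Finset.prod_div_distrib, Finset.prod_univ_sum, Fintype.piFinset_univ, Fintype.card_pi]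
  push_cast
  rfl

lemma prob_pi {ι : Type*} [Fintype ι] [DecidableEq ι] {κ : ι → Type*} [∀ i, Fintype (κ i)]
    (p : ∀ i, κ i → Prop) :
    prob (fun f : ∀ i, κ i => ∀ i, p i (f i)) = ∏ i, prob (p i) := by
  simp_rw [prob_eq_expect]
  rw [← expect_pi]
  refine Finset.expect_congr rfl fun f _ => ?_
  simpa using ind_forall_mem univ fun i => p i (f i)

/-- Coordinates in `s` contribute a factor `a`, and those in `t` a factor `b`. -/
lemma prob_pi_le {ι : Type*} [Fintype ι] [DecidableEq ι] {κ : ι → Type*} [∀ i, Fintype (κ i)]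
    (s t : Finset ι) (hst : Disjoint s t) (p q : ∀ i, κ i → Prop) {a b : ℝ}
    (hp : ∀ i ∈ s, prob (p i) ≤ a) (hq : ∀ i ∈ t, prob (q i) ≤ b) :
    prob (fun f : ∀ i, κ i => (∀ i ∈ s, p i (f i)) ∧ ∀ i ∈ t, q i (f i)) ≤ a ^ #s * b ^ #t := by
  have h : prob (fun f : ∀ i, κ i => (∀ i ∈ s, p i (f i)) ∧ ∀ i ∈ t, q i (f i)) =
      ∏ i, prob (fun x : κ i => (i ∈ s → p i x) ∧ (i ∈ t → q i x)) := by
    rw [← prob_pi]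
    exact prob_congr fun f => by constructor <;> intro h <;> simp_all
  rw [h]
  have h1 : ∀ i ∉ s ∪ t, prob (fun x : κ i => (i ∈ s → p i x) ∧ (i ∈ t → q i x)) ≤ 1 :=
    fun i _ => prob_le_one _
  calc ∏ i, prob (fun x : κ i => (i ∈ s → p i x) ∧ (i ∈ t → q i x))
      ≤ ∏ i, (if i ∈ s then a else 1) * (if i ∈ t then b else 1) := by
        refine Finset.prod_le_prod (fun i _ => prob_nonneg _) fun i _ => ?_
        by_cases his : i ∈ s
        · have hit : i ∉ t := Finset.disjoint_left.1 hst his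
          simpa [his, hit] using hp i his
        · by_cases hit : i ∈ t
          · simpa [his, hit] using hq i hit
          · simpa [his, hit] using prob_le_one _
    _ = a ^ #s * b ^ #t := by
        rw [Finset.prod_mul_distrib]
        congr 1 <;> simp [Finset.prod_ite_mem]

lemma prob_forall_mem_le {ι : Type*} [Fintype ι] [DecidableEq ι] {κ : ι → Type*}
    [∀ i, Fintype (κ i)] (s : Finset ι) (p : ∀ i, κ i → Prop) {a : ℝ} (hp : ∀ i ∈ s, prob (p i) ≤ a) :
    prob (fun f : ∀ i, κ i => ∀ i ∈ s, p i (f i)) ≤ a ^ #s := by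
  have := prob_pi_le s ∅ (Finset.disjoint_empty_right _) p p hp (b := 1) (by simp)
  simpa using this

/-- Markov's inequality. -/
lemma prob_le_expect_div {f : Ω → ℝ} (hf : ∀ ω, 0 ≤ f ω) {p : Ω → Prop} {a : ℝ} (ha : 0 < a)
    (h : ∀ ω, p ω → a ≤ f ω) : prob p ≤ (𝔼 ω, f ω) / a := by
  rw [prob_eq_expect, Finset.expect_div]
  refine Finset.expect_le_expect fun ω _ => ?_
  by_cases hp : p ω
  · rw [ind_of_true hp, le_div_iff₀ ha]; linarith [h ω hp]
  · rw [ind_of_false hp]; exact div_nonneg (hf ω) ha.le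

lemma prob_mem (s : Finset Ω) : prob (fun ω => ω ∈ s) = #s / Fintype.card Ω := by
  rw [prob]; congr 2; simp [Nat.card_eq_fintype_card]

lemma prob_mem_subtype_le (s : Finset Ω) (p : Ω → Prop) [Fintype {ω // p ω}] :
    prob (fun ω : {ω // p ω} => (ω : Ω) ∈ s) ≤ #s / Fintype.card {ω // p ω} := by
  rw [prob]
  gcongr
  rw [Nat.card_eq_fintype_card, Fintype.card_subtype]
  refine Finset.card_le_card_of_injOn (fun x => (x : Ω)) ?_ ?_
  · intro x hx; simpa using hx
  · intro x _ y _ h; exact Subtype.ext h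

/-- Resampling the coordinates outside `J` preserves the uniform distribution. -/
lemma prob_mix {ι κ : Type*} [Fintype ι] [DecidableEq ι] [Fintype κ]
    (J : Finset ι) (p : (ι → κ) → Prop) :
    prob p = prob (fun x : (ι → κ) × (ι → κ) => p (fun i => if i ∈ J then x.1 i else x.2 i)) := by
  cases isEmpty_or_nonempty (ι → κ) with
  | inl h => simp [prob_eq_expect, Finset.univ_eq_empty]
  | inr h =>
    rw [← prob_prod_fst (Ω' := ι → κ) p]
    let e : (ι → κ) × (ι → κ) ≃ (ι → κ) × (ι → κ) :=
      { toFun := fun x => (fun i => if i ∈ J then x.1 i else x.2 i,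
          fun i => if i ∈ J then x.2 i else x.1 i)
        invFun := fun x => (fun i => if i ∈ J then x.1 i else x.2 i,
          fun i => if i ∈ J then x.2 i else x.1 i)
        left_inv := fun x => by ext i <;> by_cases hi : i ∈ J <;> simp [hi]
        right_inv := fun x => by ext i <;> by_cases hi : i ∈ J <;> simp [hi] }
    rw [← prob_equiv e]
    rfl

/-- Restricting a uniformly random function along an injection gives a uniformly random
function. -/
lemma prob_comp_injective {K K' W : Type*} [Fintype K] [DecidableEq K] [Fintype K']
    [DecidableEq K'] [Fintype W] [Nonempty W]
    (ι : K' → K) (hι : Injective ι) (p : (K' → W) → Prop) :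
    prob (fun f : K → W => p (f ∘ ι)) = prob p := by
  let e : K' ⊕ ((Set.range ι)ᶜ : Set K) ≃ K :=
    (Equiv.sumCongr (Equiv.ofInjective ι hι) (Equiv.refl _)).trans (Equiv.Set.sumCompl _)
  let E : (K → W) ≃ (K' → W) × (((Set.range ι)ᶜ : Set K) → W) :=
    (Equiv.arrowCongr e.symm (Equiv.refl W)).trans (Equiv.sumArrowEquivProdArrow _ _ _)
  rw [← prob_prod_fst (Ω' := ((Set.range ι)ᶜ : Set K) → W) p, ← prob_equiv E]
  rfl

end Prob

section Permutations

open Finset Function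
open scoped BigOperators

variable {I : Type*} [Fintype I] [DecidableEq I]

/-- The involution `(σ, y) ↦ (σ * swap j y, y)`. -/
def swapResample (J : Finset I) (j : I) :
    Equiv.Perm I × {y // y ∉ J} ≃ Equiv.Perm I × {y // y ∉ J} where
  toFun x := (x.1 * Equiv.swap j x.2, x.2)
  invFun x := (x.1 * Equiv.swap j x.2, x.2)
  left_inv x := by simp [mul_assoc]
  right_inv x := by simp [mul_assoc]

lemma prob_perm_avoid_insert (J T : Finset I) {j : I} (hj : j ∉ J) :
    prob (fun σ : Equiv.Perm I => ∀ i ∈ insert j J, σ i ∉ T) =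
      prob (fun σ : Equiv.Perm I => ∀ i ∈ J, σ i ∉ T) *
        (1 - #T / (Fintype.card I - #J)) := by
  have : Nonempty {y // y ∉ J} := ⟨⟨j, hj⟩⟩
  rw [← prob_prod_fst (Ω' := {y // y ∉ J})
    (fun σ : Equiv.Perm I => ∀ i ∈ insert j J, σ i ∉ T), ← prob_equiv (swapResample J j),
    prob_prod, prob_eq_expect, Finset.expect_mul]
  refine Finset.expect_congr rfl fun σ _ => ?_
  have key : ∀ y : {y // y ∉ J},
      (∀ i ∈ insert j J, (swapResample J j (σ, y)).1 i ∉ T) ↔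
        (∀ i ∈ J, σ i ∉ T) ∧ ¬ σ y ∈ T := by
    intro y
    rw [Finset.forall_mem_insert, and_comm]
    have h1 : ∀ i ∈ J, (swapResample J j (σ, y)).1 i = σ i := by
      intro i hi
      have hij : i ≠ j := fun h => hj (h ▸ hi)
      have hiy : i ≠ y := fun h => y.2 (h ▸ hi)
      simp [swapResample, Equiv.swap_apply_of_ne_of_ne hij hiy]
    refine and_congr (forall₂_congr fun i hi => by rw [h1 i hi]) ?_
    simp [swapResample]
  rw [prob_congr key]
  by_cases hA : ∀ i ∈ J, σ i ∉ T
  · rw [ind_of_true hA, one_mul]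
    rw [prob_congr (q := fun y : {y // y ∉ J} => ¬ σ y ∈ T) (fun y => by tauto), prob_not]
    congr 1
    have hc : (Fintype.card {y // y ∉ J} : ℝ) = Fintype.card I - #J := by
      rw [Fintype.card_subtype_compl, Nat.cast_sub (by simpa using Finset.card_le_univ J)]
      simp
    rw [prob, hc]
    congr 2
    rw [Nat.card_eq_fintype_card, ← Fintype.card_coe]
    refine Fintype.card_congr
      { toFun := fun y => ⟨σ y.1, y.2⟩
        invFun := fun t => ⟨⟨σ.symm t, fun h => hA _ h (by simp)⟩, by simp⟩
        left_inv := fun y => by simp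
        right_inv := fun t => by simp }
  · rw [ind_of_false hA, zero_mul]
    rw [prob_congr (q := fun y : {y // y ∉ J} => False) (fun y => by tauto)]
    simp [prob]

/-- The probability that a random permutation maps a `j`-set into the complement of a
`t`-set. -/
lemma prob_perm_avoid (J T : Finset I) :
    prob (fun σ : Equiv.Perm I => ∀ i ∈ J, σ i ∉ T) =
      ∏ l ∈ range #J, (1 - #T / (Fintype.card I - l) : ℝ) := by
  induction J using Finset.induction_on with
  | empty => simpa using prob_true (Ω := Equiv.Perm I)
  | insert j J hj ih =>
    rw [prob_perm_avoid_insert J T hj, ih, Finset.card_insert_of_notMem hj,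
      Finset.prod_range_succ]

lemma prob_perm_avoid_le (J T : Finset I) :
    prob (fun σ : Equiv.Perm I => ∀ i ∈ J, σ i ∉ T) ≤ (1 - #T / Fintype.card I : ℝ) ^ #J := by
  induction J using Finset.induction_on with
  | empty => simpa using (prob_true (Ω := Equiv.Perm I)).le
  | insert j J hj ih =>
    rw [prob_perm_avoid_insert J T hj, Finset.card_insert_of_notMem hj, pow_succ]
    have hlt : #J < Fintype.card I :=
      (Finset.card_lt_univ_of_notMem hj)
    have hlt' : (0 : ℝ) < Fintype.card I - #J := by
      rw [sub_pos]; exact_mod_cast hlt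
    have hT : (#T : ℝ) / Fintype.card I ≤ 1 :=
      div_le_one_of_le₀ (by exact_mod_cast Finset.card_le_univ T) (by positivity)
    have hle : (1 - #T / (Fintype.card I - #J) : ℝ) ≤ 1 - #T / Fintype.card I := by
      have := div_le_div_of_nonneg_left (Nat.cast_nonneg (α := ℝ) #T) hlt'
        (sub_le_self _ (Nat.cast_nonneg (α := ℝ) #J))
      linarith
    exact (mul_le_mul_of_nonneg_left hle (prob_nonneg _)).trans
      (mul_le_mul_of_nonneg_right ih (sub_nonneg.2 hT))

lemma prob_perm_mem (i : I) (T : Finset I) :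
    prob (fun σ : Equiv.Perm I => σ i ∈ T) = #T / Fintype.card I := by
  have h := prob_perm_avoid {i} T
  have h2 := prob_not (fun σ : Equiv.Perm I => σ i ∈ T)
  simp at h
  rw [h] at h2
  linarith

/-- The moment generating function of a hypergeometric variable is at most that of the
corresponding binomial one. -/
lemma expect_perm_pow_le (A B : Finset I) {x : ℝ} (hx0 : 0 ≤ x) (hx1 : x ≤ 1) :
    𝔼 σ : Equiv.Perm I, x ^ #{a ∈ A | σ a ∈ B} ≤
      (1 - (1 - x) * (#B / Fintype.card I)) ^ #A := by
  have h1 : ∀ σ : Equiv.Perm I, x ^ #{a ∈ A | σ a ∈ B} =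
      ∑ M ∈ A.powerset, (1 - x) ^ #M * x ^ (#A - #M) * ind (∀ i ∈ M, σ i ∉ B) := by
    intro σ
    have h2 : x ^ #{a ∈ A | σ a ∈ B} = ∏ a ∈ A, ((1 - x) * ind (σ a ∉ B) + x) := by
      rw [← Finset.prod_const, Finset.prod_filter]
      refine Finset.prod_congr rfl fun a _ => ?_
      by_cases h : σ a ∈ B
      · simp [h, ind]
      · simp [h, ind]
    rw [h2, Finset.prod_add]
    refine Finset.sum_congr rfl fun M hM => ?_
    rw [Finset.prod_mul_distrib, Finset.prod_const, Finset.prod_const, ind_forall_mem,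
      Finset.card_sdiff_of_subset (Finset.mem_powerset.1 hM)]
    ring
  simp_rw [h1]
  rw [Finset.expect_sum_comm]
  calc _ ≤ ∑ M ∈ A.powerset, ((1 - x) * (1 - #B / Fintype.card I)) ^ #M * x ^ (#A - #M) := by
        refine Finset.sum_le_sum fun M _ => ?_
        rw [← Finset.mul_expect, mul_pow, ← prob_eq_expect]
        have h3 : 0 ≤ (1 - x) ^ #M * x ^ (#A - #M) :=
          mul_nonneg (pow_nonneg (by linarith) _) (pow_nonneg hx0 _)
        calc _ ≤ (1 - x) ^ #M * x ^ (#A - #M) * (1 - #B / Fintype.card I : ℝ) ^ #M :=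
              mul_le_mul_of_nonneg_left (prob_perm_avoid_le M B) h3
          _ = _ := by ring
    _ = _ := by
        rw [Finset.sum_pow_mul_eq_add_pow]
        congr 1
        ring

end Permutations

section UnionBounds

open Finset Function
open scoped Classical BigOperators

set_option linter.unusedSectionVars false

variable {Ω V W : Type*} [Fintype Ω] [Fintype V] [DecidableEq V] [Fintype W]

lemma sum_Icc_pow_le {η : ℝ} (h0 : 0 ≤ η) (h1 : η ≤ 1 / 2) (N : ℕ) :
    ∑ s ∈ Icc 1 N, η ^ s ≤ 2 * η := by
  have h : ∑ s ∈ Icc 1 N, η ^ s ≤ 2 * η - 2 * (η ^ N * η) := by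
    induction N with
    | zero => simp
    | succ N ih =>
      rw [Finset.sum_Icc_succ_top (by omega), pow_succ]
      have := pow_nonneg h0 N
      nlinarith [mul_nonneg (mul_nonneg this h0) (sub_nonneg.2 h1)]
  linarith [mul_nonneg (pow_nonneg h0 N) h0]

lemma prob_exists_card_le (U : Finset V) (p : Finset V → Ω → Prop) (a : ℕ → ℝ) (L : ℕ)
    (h : ∀ Q ⊆ U, Q.Nonempty → #Q ≤ L → prob (p Q) ≤ a #Q) :
    prob (fun ω => ∃ Q ⊆ U, Q.Nonempty ∧ #Q ≤ L ∧ p Q ω) ≤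
      ∑ s ∈ Icc 1 L, (#U).choose s * a s := by
  calc _ ≤ prob (fun ω => ∃ s ∈ Icc 1 L, ∃ Q ∈ powersetCard s U, p Q ω) := by
        refine prob_mono fun ω ⟨Q, hQ, hne, hL, hp⟩ => ⟨#Q, ?_, Q, ?_, hp⟩
        · exact Finset.mem_Icc.2 ⟨hne.card_pos, hL⟩
        · exact Finset.mem_powersetCard.2 ⟨hQ, rfl⟩
    _ ≤ ∑ s ∈ Icc 1 L, prob (fun ω => ∃ Q ∈ powersetCard s U, p Q ω) := prob_exists_le _ _
    _ ≤ _ := by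
        refine Finset.sum_le_sum fun s hs => ?_
        obtain ⟨hs1, hs2⟩ := Finset.mem_Icc.1 hs
        refine (prob_exists_le _ _).trans ?_
        rw [← Finset.card_powersetCard, ← nsmul_eq_mul]
        refine Finset.sum_le_card_nsmul _ _ _ fun Q hQ => ?_
        obtain ⟨hQU, rfl⟩ := Finset.mem_powersetCard.1 hQ
        exact h Q hQU (Finset.card_pos.1 hs1) hs2

lemma prob_exists_pair_le (U : Finset W) (p : Finset V → Finset W → Ω → Prop) (a : ℕ → ℝ)
    (L : ℕ) (h : ∀ Q Y, Q.Nonempty → #Q ≤ L → Y ⊆ U → #Y = #Q → prob (p Q Y) ≤ a #Q) :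
    prob (fun ω => ∃ Q : Finset V, Q.Nonempty ∧ #Q ≤ L ∧ ∃ Y ⊆ U, #Y = #Q ∧ p Q Y ω) ≤
      ∑ s ∈ Icc 1 L, (Fintype.card V).choose s * ((#U).choose s * a s) := by
  have := prob_exists_card_le (univ : Finset V)
    (fun Q ω => ∃ Y ⊆ U, #Y = #Q ∧ p Q Y ω) (fun s => (#U).choose s * a s) L ?_
  · simpa using this
  intro Q _ hQ hL
  calc _ ≤ prob (fun ω => ∃ Y ∈ powersetCard #Q U, p Q Y ω) := by
        refine prob_mono fun ω ⟨Y, hY, hc, hp⟩ => ⟨Y, ?_, hp⟩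
        exact Finset.mem_powersetCard.2 ⟨hY, hc⟩
    _ ≤ _ := prob_exists_le _ _
    _ ≤ _ := by
        rw [← Finset.card_powersetCard, ← nsmul_eq_mul]
        refine Finset.sum_le_card_nsmul _ _ _ fun Y hY => ?_
        obtain ⟨hYU, hc⟩ := Finset.mem_powersetCard.1 hY
        exact h Q Y hQ hL hYU hc

lemma choose_mul_pow_le (n s : ℕ) {d : ℝ} (hd : 0 ≤ d) :
    n.choose s * (s * d) ^ s ≤ (Real.exp 1 * n * d) ^ s := by
  have h1 : (n.choose s : ℝ) ≤ n ^ s / s.factorial := Nat.choose_le_pow_div s n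
  have h2 : (s : ℝ) ^ s / s.factorial ≤ Real.exp s :=
    Real.pow_div_factorial_le_exp (s : ℝ) (by positivity) s
  have h3 : Real.exp (s : ℝ) = Real.exp 1 ^ s := by rw [← Real.exp_nat_mul, mul_one]
  calc _ ≤ n ^ s / s.factorial * (s * d) ^ s := by gcongr
    _ = n ^ s * d ^ s * (s ^ s / s.factorial) := by ring
    _ ≤ n ^ s * d ^ s * Real.exp s := by gcongr
    _ = _ := by rw [h3]; ring

/-- The probability that a random function collides on `S`. -/
lemma prob_not_injOn_le [Nonempty W] (S : Finset V) :
    prob (fun c : V → W => ¬ Set.InjOn c S) ≤ (#S : ℝ) ^ 2 / Fintype.card W := by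
  calc _ ≤ prob (fun c : V → W => ∃ x ∈ S.offDiag, c x.1 = c x.2) := by
        refine prob_mono fun c h => ?_
        simp only [Set.InjOn] at h
        push Not at h
        obtain ⟨a, ha, b, hb, hab, hne⟩ := h
        exact ⟨(a, b), Finset.mem_offDiag.2 ⟨ha, hb, hne⟩, hab⟩
    _ ≤ ∑ x ∈ S.offDiag, prob (fun c : V → W => c x.1 = c x.2) := prob_exists_le _ _
    _ ≤ ∑ x ∈ S.offDiag, 1 / (Fintype.card W : ℝ) := by
        refine Finset.sum_le_sum fun x hx => ?_
        rw [prob_mix {x.2}]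
        refine prob_prod_le' (by positivity) fun b => ?_
        have hne := (Finset.mem_offDiag.1 hx).2.2
        have h := prob_pi_le (κ := fun _ : V => W) {x.2} ∅ (by simp) (fun _ w => w = b x.1)
          (fun _ _ => True) (a := 1 / (Fintype.card W : ℝ)) (b := 1) ?_ (by simp)
        · simpa [hne, eq_comm] using h
        · intro i _
          have := prob_mem ({b x.1} : Finset W)
          simpa using this.le
    _ ≤ _ := by
        rw [Finset.sum_const, nsmul_eq_mul, mul_one_div, Finset.offDiag_card]
        gcongr
        rw [sq]
        exact_mod_cast Nat.sub_le _ _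

end UnionBounds

section Colours

open Finset Function
open scoped Classical BigOperators

set_option linter.unusedSectionVars false

variable {V W : Type*} [Fintype V] [DecidableEq V] [Fintype W] {k : ℕ}

lemma prob_pi_apply_le {ι κ : Type*} [Fintype ι] [DecidableEq ι] [Fintype κ] (i : ι) (p : κ → Prop)
    {a : ℝ} (hp : prob p ≤ a) : prob (fun f : ι → κ => p (f i)) ≤ a := by
  simpa using prob_forall_mem_le (κ := fun _ : ι => κ) {i} (fun _ => p) (a := a) (by simpa)

/-- A random `k`-tuple of colours rarely has at most two entries in a large set. -/
lemma prob_card_mem_le_two (W₀ : Finset W) {p : ℝ} (hp : p ≤ #W₀ / Fintype.card W)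
    (hp1 : p ≤ 1) :
    prob (fun c : Fin k → W => #{i | c i ∈ W₀} ≤ 2) ≤ 4 * (1 - p / 2) ^ k := by
  have h := prob_le_expect_div (Ω := Fin k → W) (f := fun c => ∏ i, (if c i ∈ W₀ then 1 / 2 else 1))
    (fun c => Finset.prod_nonneg fun i _ => by split_ifs <;> norm_num)
    (p := fun c => #{i | c i ∈ W₀} ≤ 2) (a := 1 / 4) (by norm_num) ?_
  · refine h.trans ?_
    rw [expect_pi (fun _ w => if w ∈ W₀ then (1 / 2 : ℝ) else 1), Finset.prod_const,
      Finset.card_univ, Fintype.card_fin, div_eq_mul_inv, mul_comm]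
    have h2 : (𝔼 w : W, if w ∈ W₀ then (1 / 2 : ℝ) else 1) ≤ 1 - p / 2 := by
      cases isEmpty_or_nonempty W
      · simp; linarith
      have h3 : (𝔼 w : W, if w ∈ W₀ then (1 / 2 : ℝ) else 1) =
          𝔼 w : W, (1 - 1 / 2 * ind (w ∈ W₀)) :=
        Finset.expect_congr rfl fun w _ => by by_cases h : w ∈ W₀ <;> norm_num [h, ind]
      rw [h3, Finset.expect_sub_distrib, Fintype.expect_const, ← Finset.mul_expect,
        ← prob_eq_expect, prob_mem]
      linarith
    have h4 : (0 : ℝ) ≤ 𝔼 w : W, if w ∈ W₀ then (1 / 2 : ℝ) else 1 :=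
      Finset.expect_nonneg fun w _ => by split_ifs <;> norm_num
    norm_num
    gcongr
  · intro c hc
    rw [Finset.prod_ite, Finset.prod_const, Finset.prod_const_one, mul_one]
    calc (1 / 4 : ℝ) = (1 / 2) ^ 2 := by norm_num
      _ ≤ _ := pow_le_pow_of_le_one (by norm_num) (by norm_num) hc

/-- Few vertices see at most two colours of a large set. -/
lemma prob_many_le (X : Finset V) (q : (Fin k → W) → Prop) [DecidablePred q] {a b : ℝ} (hb : 0 < b)
    (hq : prob q ≤ a) :
    prob (fun c : V → Fin k → W => b < #{v ∈ X | q (c v)}) ≤ #X * a / b := by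
  refine (prob_le_expect_div (f := fun c : V → Fin k → W => ∑ v ∈ X, ind (q (c v)))
    (fun c => Finset.sum_nonneg fun v _ => ind_nonneg _) hb ?_).trans ?_
  · intro c hc
    rw [Finset.card_filter] at hc
    push_cast at hc
    refine hc.le.trans (Finset.sum_le_sum fun v _ => ?_)
    by_cases h : q (c v) <;> simp [ind, h]
  · rw [Finset.expect_sum_comm]
    gcongr
    rw [← nsmul_eq_mul]
    refine Finset.sum_le_card_nsmul _ _ _ fun v _ => ?_
    rw [← prob_eq_expect]
    exact prob_pi_apply_le v q hq

lemma prob_forall_mem_pow_le [Nonempty W] (G : Finset W) {a : ℝ}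
    (ha : (#G : ℝ) / Fintype.card W ≤ a) :
    prob (fun c : Fin k → W => ∀ i, c i ∈ G) ≤ a ^ k := by
  have := prob_forall_mem_le (κ := fun _ : Fin k => W) univ (fun _ w => w ∈ G) (a := a)
    (fun _ _ => by rw [prob_mem]; exact ha)
  simpa using this

/-- No small set of vertices has all its colours in `F` and few other colours. -/
lemma prob_trapped_le [Nonempty W] (F : Finset W) (L : ℕ) {a : ℝ} (ha : 0 ≤ a)
    (hF : (#F + L : ℝ) ≤ a * Fintype.card W)
    (hη : Fintype.card V * Fintype.card W * a ^ k ≤ 1 / 2) :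
    prob (fun c : V → Fin k → W => ∃ Q : Finset V, Q.Nonempty ∧ #Q ≤ L ∧
      ∃ Y ⊆ (univ : Finset W), #Y = #Q ∧ ∀ v ∈ Q, ∀ i, c v i ∈ F ∪ Y) ≤
      2 * (Fintype.card V * Fintype.card W * a ^ k) := by
  have hW : (0 : ℝ) < Fintype.card W := by exact_mod_cast Fintype.card_pos
  refine (prob_exists_pair_le (univ : Finset W)
    (fun Q Y (c : V → Fin k → W) => ∀ v ∈ Q, ∀ i, c v i ∈ F ∪ Y) (fun s => (a ^ k) ^ s) L ?_).trans
    ?_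
  · intro Q Y _ hL _ hY
    refine prob_forall_mem_le (κ := fun _ : V => Fin k → W) Q (fun _ c => ∀ i, c i ∈ F ∪ Y)
      fun _ _ => prob_forall_mem_pow_le _ ?_
    rw [div_le_iff₀ hW]
    refine le_trans ?_ hF
    have h1 := Finset.card_union_le F Y
    have h2 : #(F ∪ Y) ≤ #F + L := by omega
    exact_mod_cast h2
  · refine le_trans ?_ (sum_Icc_pow_le (by positivity) hη L)
    refine Finset.sum_le_sum fun s _ => ?_
    rw [mul_pow, mul_pow, mul_assoc, Finset.card_univ]
    gcongr
    · exact_mod_cast Nat.choose_le_pow _ _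
    · exact_mod_cast Nat.choose_le_pow _ _

lemma prob_hits_mem_le [Nonempty W] (W₀ Y : Finset W) (hY : Y ⊆ W₀) (hne : Y.Nonempty) :
    prob (fun c : Fin k → W => 3 ≤ #{i | c i ∈ W₀} ∧ ∀ i, c i ∈ W₀ → c i ∈ Y) ≤
      (#Y / #W₀ : ℝ) ^ 3 := by
  have hY0 : (0 : ℝ) < #Y := by exact_mod_cast hne.card_pos
  have hle : (#Y : ℝ) ≤ #W₀ := by exact_mod_cast Finset.card_le_card hY
  have hW₀ : (0 : ℝ) < #W₀ := hY0.trans_le hle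
  set ρ : ℝ := #Y / #W₀ with hρ
  have hρ0 : 0 < ρ := by positivity
  have hρ1 : ρ ≤ 1 := div_le_one_of_le₀ hle hW₀.le
  let g : W → ℝ := fun w => if w ∈ W₀ then (if w ∈ Y then ρ⁻¹ else 0) else 1
  have hg0 : ∀ w, 0 ≤ g w := fun w => by
    simp only [g]; split_ifs <;> positivity
  have h := prob_le_expect_div (Ω := Fin k → W) (f := fun c => ∏ i, g (c i))
    (fun c => Finset.prod_nonneg fun i _ => hg0 _)
    (p := fun c => 3 ≤ #{i | c i ∈ W₀} ∧ ∀ i, c i ∈ W₀ → c i ∈ Y) (a := (ρ ^ 3)⁻¹)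
    (by positivity) ?_
  · refine h.trans ?_
    have h1 : 𝔼 w, g w = 1 := by
      have h2 : ∀ w, g w = ρ⁻¹ * ind (w ∈ Y) + (1 - ind (w ∈ W₀)) := by
        intro w
        by_cases h : w ∈ Y
        · simp [g, h, hY h, ind]
        · by_cases h' : w ∈ W₀ <;> simp [g, h, h', ind]
      simp_rw [h2]
      rw [Finset.expect_add_distrib, Finset.expect_sub_distrib, ← Finset.mul_expect,
        Fintype.expect_const, ← prob_eq_expect, ← prob_eq_expect, prob_mem, prob_mem, hρ]
      field_simp
      ring
    rw [expect_pi (fun _ w => g w)]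
    simp [h1]
  · rintro c ⟨h3, hc⟩
    have h4 : ∀ i, g (c i) = if c i ∈ W₀ then ρ⁻¹ else 1 := fun i => by
      by_cases h : c i ∈ W₀ <;> simp [g, h, hc]
    simp_rw [h4]
    rw [Finset.prod_ite, Finset.prod_const, Finset.prod_const_one, mul_one, ← inv_pow]
    exact pow_le_pow_right₀ (one_le_inv₀ hρ0 |>.2 hρ1) h3

/-- No small set of vertices, each seeing three colours of `W₀`, sees too few of them. -/
lemma prob_hall_small_le [Nonempty W] (W₀ : Finset W) (L : ℕ) {η : ℝ} (hL : L ≤ #W₀)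
    (hη : 9 * Fintype.card V * L ≤ η * (#W₀ : ℝ) ^ 2) (hη0 : 0 ≤ η) (hη2 : η ≤ 1 / 2) :
    prob (fun c : V → Fin k → W => ∃ Q : Finset V, Q.Nonempty ∧ #Q ≤ L ∧
      ∃ Y ⊆ W₀, #Y = #Q ∧ ∀ v ∈ Q, 3 ≤ #{i | c v i ∈ W₀} ∧ ∀ i, c v i ∈ W₀ → c v i ∈ Y) ≤
      2 * η := by
  refine (prob_exists_pair_le W₀ (fun Q Y (c : V → Fin k → W) => ∀ v ∈ Q,
    3 ≤ #{i | c v i ∈ W₀} ∧ ∀ i, c v i ∈ W₀ → c v i ∈ Y)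
    (fun s => ((s / #W₀ : ℝ) ^ 3) ^ s) L ?_).trans ?_
  · intro Q Y hQ _ hY hYQ
    refine prob_forall_mem_le (κ := fun _ : V => Fin k → W) Q (fun _ (c : Fin k → W) =>
      3 ≤ #{i | c i ∈ W₀} ∧ ∀ i, c i ∈ W₀ → c i ∈ Y) fun _ _ => ?_
    rw [← hYQ]
    refine prob_hits_mem_le W₀ Y hY (Finset.card_pos.1 ?_)
    rw [hYQ]; exact hQ.card_pos
  · rcases Nat.eq_zero_or_pos L with rfl | hL0
    · simpa using hη0
    have hw : (0 : ℝ) < #W₀ := by exact_mod_cast hL0.trans_le hL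
    refine le_trans ?_ (sum_Icc_pow_le hη0 hη2 L)
    refine Finset.sum_le_sum fun s hs => ?_
    have hsL : (s : ℝ) ≤ L := by exact_mod_cast (Finset.mem_Icc.1 hs).2
    have he : Real.exp 1 ≤ 3 := Real.exp_one_lt_d9.le.trans (by norm_num)
    calc _ = ((Fintype.card V).choose s * (s * (#W₀ : ℝ)⁻¹) ^ s) *
          ((#W₀).choose s * (s * (#W₀ : ℝ)⁻¹) ^ s) * (s / #W₀ : ℝ) ^ s := by
          rw [← div_eq_mul_inv]; ring
      _ ≤ (Real.exp 1 * Fintype.card V * (#W₀ : ℝ)⁻¹) ^ s *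
          (Real.exp 1 * #W₀ * (#W₀ : ℝ)⁻¹) ^ s * (s / #W₀ : ℝ) ^ s := by
          gcongr
          · exact choose_mul_pow_le _ _ (by positivity)
          · exact choose_mul_pow_le _ _ (by positivity)
      _ = (Real.exp 1 ^ 2 * Fintype.card V * s / (#W₀ : ℝ) ^ 2) ^ s := by
          rw [← mul_pow, ← mul_pow]
          congr 1
          field_simp
      _ ≤ η ^ s := by
          gcongr
          rw [div_le_iff₀ (by positivity)]
          refine le_trans ?_ hη
          gcongr
          nlinarith [Real.exp_pos 1]

/-- No large set of vertices misses a large set of colours. -/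
lemma prob_hall_large_le [Nonempty W] (L b : ℕ) {δ : ℝ}
    (hδ : (2 : ℝ) ^ Fintype.card V * 2 ^ Fintype.card W *
      Real.exp (-(b / Fintype.card W) * (k * L)) ≤ δ) :
    prob (fun c : V → Fin k → W => ∃ Q : Finset V, L ≤ #Q ∧ ∃ Y : Finset W, b ≤ #Y ∧
      ∀ v ∈ Q, ∀ i, c v i ∉ Y) ≤ δ := by
  have hW : (0 : ℝ) < Fintype.card W := by exact_mod_cast Fintype.card_pos
  refine le_trans ?_ hδ
  calc _ ≤ prob (fun c : V → Fin k → W => ∃ x ∈ (univ : Finset (Finset V × Finset W)),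
        (L ≤ #x.1 ∧ b ≤ #x.2 ∧ ∀ v ∈ x.1, ∀ i, c v i ∉ x.2)) := by
        refine prob_mono ?_
        rintro c ⟨Q, hQ, Y, hY, h⟩
        exact ⟨(Q, Y), by simp, hQ, hY, h⟩
    _ ≤ _ := prob_exists_le _ _
    _ ≤ ∑ _x : Finset V × Finset W, Real.exp (-(b / Fintype.card W) * (k * L)) := by
        refine Finset.sum_le_sum fun x _ => ?_
        by_cases hL : L ≤ #x.1
        · by_cases hb : b ≤ #x.2
          · have hY1 : (#x.2 : ℝ) ≤ Fintype.card W := by exact_mod_cast Finset.card_le_univ _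
            have hbY : (b : ℝ) ≤ #x.2 := by exact_mod_cast hb
            have hLQ : (L : ℝ) ≤ #x.1 := by exact_mod_cast hL
            calc _ ≤ prob (fun c : V → Fin k → W => ∀ v ∈ x.1, ∀ i, c v i ∈ x.2ᶜ) :=
                  prob_mono fun c h => by simpa using h.2.2
              _ ≤ ((1 - b / Fintype.card W : ℝ) ^ k) ^ #x.1 := by
                  refine prob_forall_mem_le (κ := fun _ : V => Fin k → W) x.1
                    (fun _ c => ∀ i, c i ∈ x.2ᶜ) fun _ _ => prob_forall_mem_pow_le _ ?_
                  rw [Finset.card_compl, Nat.cast_sub (Finset.card_le_univ _), sub_div,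
                    div_self hW.ne']
                  gcongr
              _ ≤ ((Real.exp (-(b / Fintype.card W))) ^ k) ^ #x.1 := by
                  have h0 : (0 : ℝ) ≤ 1 - b / Fintype.card W :=
                    sub_nonneg.2 (div_le_one_of_le₀ (hbY.trans hY1) hW.le)
                  gcongr
                  exact Real.one_sub_le_exp_neg _
              _ = Real.exp (-(b / Fintype.card W) * (k * #x.1)) := by
                  rw [← Real.exp_nat_mul, ← Real.exp_nat_mul]
                  congr 1; ring
              _ ≤ _ := by
                  rw [Real.exp_le_exp, neg_mul, neg_mul]
                  gcongr
          · rw [prob_congr (q := fun _ => False) (fun c => by simp [hb])]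
            simpa [prob] using (Real.exp_pos _).le
        · rw [prob_congr (q := fun _ => False) (fun c => by simp [hL])]
          simpa [prob] using (Real.exp_pos _).le
    _ = _ := by
        simp [Finset.card_univ]

end Colours

section Growth

open Finset Function
open scoped Classical BigOperators

set_option linter.unusedSectionVars false

lemma prob_exists_subset_le {Ω V : Type*} [Fintype Ω] (U : Finset V) (p : Finset V → Ω → Prop)
    (a : ℕ → ℝ) (h : ∀ Q ⊆ U, prob (p Q) ≤ a #Q) :
    prob (fun ω => ∃ Q ⊆ U, p Q ω) ≤ ∑ r ∈ range (#U + 1), (#U).choose r * a r := by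
  calc _ ≤ prob (fun ω => ∃ Q ∈ U.powerset, p Q ω) :=
        prob_mono fun ω ⟨Q, hQ, hp⟩ => ⟨Q, Finset.mem_powerset.2 hQ, hp⟩
    _ ≤ ∑ Q ∈ U.powerset, prob (p Q) := prob_exists_le _ _
    _ ≤ ∑ Q ∈ U.powerset, a #Q :=
        Finset.sum_le_sum fun Q hQ => h Q (Finset.mem_powerset.1 hQ)
    _ = _ := by rw [Finset.sum_powerset_apply_card]; simp

variable {V I W : Type*} [Fintype V] [DecidableEq V] [Fintype I] [DecidableEq I] [Fintype W]
  [Nonempty W] {k : ℕ}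

lemma card_filter_mem_le {t : I → V} (ht : Injective t) (S : Finset V) :
    #{y | t y ∈ S} ≤ #S :=
  Finset.card_le_card_of_injOn t (fun y hy => by simpa using hy) ht.injOn

lemma prob_perm_tail_le {t : I → V} (ht : Injective t) (S : Finset V) (i : I) :
    prob (fun σ : Equiv.Perm I => t (σ i) ∈ S) ≤ #S / Fintype.card I := by
  have h := prob_perm_mem i ({y | t y ∈ S} : Finset I)
  simp only [Finset.mem_filter, Finset.mem_univ, true_and] at h
  rw [h]
  gcongr
  exact card_filter_mem_le ht S

lemma prob_no_extension_le {t : I → V} (S : Finset V) (hS : ∀ v ∈ S, ∃ y, t y = v)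
    (a : Fin k → I) (ha : Injective a) (G : Finset W) :
    prob (fun x : Equiv.Perm I × (Fin k → W) => ∀ i, ¬ (t (x.1 (a i)) ∈ S ∧ x.2 i ∉ G)) ≤
      (1 - (1 - #G / Fintype.card W) * (#S / Fintype.card I) : ℝ) ^ k := by
  have hW : (0 : ℝ) < Fintype.card W := by exact_mod_cast Fintype.card_pos
  set x : ℝ := #G / Fintype.card W with hx
  have hx1 : x ≤ 1 := div_le_one_of_le₀ (by exact_mod_cast Finset.card_le_univ G) hW.le
  set B : Finset I := {y | t y ∈ S} with hB
  have hBS : #S ≤ #B := by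
    refine (Finset.card_le_card fun v hv => ?_).trans (Finset.card_image_le (s := B) (f := t))
    obtain ⟨y, hy⟩ := hS v hv
    exact Finset.mem_image.2 ⟨y, by simpa [hB, hy] using hv, hy⟩
  have hBI : (#B : ℝ) / Fintype.card I ≤ 1 :=
    div_le_one_of_le₀ (by exact_mod_cast Finset.card_le_univ B) (by positivity)
  rw [prob_prod]
  calc _ ≤ 𝔼 σ : Equiv.Perm I, x ^ #{j ∈ univ.image a | σ j ∈ B} := by
        refine Finset.expect_le_expect fun σ _ => ?_
        have hc : #{j ∈ univ.image a | σ j ∈ B} = #{i | t (σ (a i)) ∈ S} := by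
          rw [Finset.filter_image, Finset.card_image_of_injective _ ha]
          simp [hB]
        rw [hc]
        have h := prob_forall_mem_le (κ := fun _ : Fin k => W) {i | t (σ (a i)) ∈ S}
          (fun _ w => w ∈ G) (a := x) (fun _ _ => (prob_mem G).le)
        refine le_trans (prob_mono fun c hc i hi => ?_) h
        have := hc i
        simp at hi
        tauto
    _ ≤ _ := expect_perm_pow_le _ _ (by positivity) hx1
    _ ≤ _ := by
        rw [Finset.card_image_of_injective _ ha, Finset.card_univ, Fintype.card_fin]
        refine pow_le_pow_left₀ ?_ ?_ k
        · have : (0 : ℝ) ≤ x := by positivity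
          have : (0 : ℝ) ≤ #B / Fintype.card I := by positivity
          nlinarith
        · have : (#S : ℝ) / Fintype.card I ≤ #B / Fintype.card I := by gcongr
          nlinarith

/-- The vertex set `S` with the choice `j` of parents is a partial structure which admits no
extension to a vertex outside `S ∪ B` by means of a colour outside `F`. -/
def Stuck (t : V → I → V) (a : V → Fin k → I) (u : V) (B : Finset V) (F : Finset W)
    (ω : V → Equiv.Perm I × (Fin k → W)) (S : Finset V) (j : V → Fin k) : Prop :=
  (∀ v ∈ S.erase u, t v ((ω v).1 (a v (j v))) ∈ S) ∧
    ∀ v ∈ (S ∪ B)ᶜ, ∀ i, ¬ (t v ((ω v).1 (a v i)) ∈ S ∧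
      (ω v).2 i ∉ F ∪ (S.erase u).image fun w => (ω w).2 (j w))

lemma prob_stuck_le {t : V → I → V} (ht : ∀ v, Injective (t v))
    (ht' : ∀ v w, w ≠ v → ∃ y, t v y = w) {a : V → Fin k → I} (ha : ∀ v, Injective (a v))
    (u : V) (B : Finset V) (F : Finset W) (S : Finset V) (j : V → Fin k) (g : ℕ)
    (hg : #F + #S ≤ g)
    (hgW : g ≤ Fintype.card W) :
    prob (fun ω => Stuck t a u B F ω S j) ≤
      (#S / Fintype.card I : ℝ) ^ #(S.erase u) *
        ((1 - (1 - g / Fintype.card W) * (#S / Fintype.card I) : ℝ) ^ k) ^ #(S ∪ B)ᶜ := by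
  have hW : (0 : ℝ) < Fintype.card W := by exact_mod_cast Fintype.card_pos
  rw [prob_mix S, prob_prod]
  have hSI : ∀ v ∉ S, (#S : ℝ) / Fintype.card I ≤ 1 := by
    intro v hvS
    refine div_le_one_of_le₀ ?_ (by positivity)
    have : #S ≤ Fintype.card I := by
      refine (Finset.card_le_card fun w hw => ?_).trans
        (Finset.card_image_le (s := univ) (f := t v))
      obtain ⟨y, hy⟩ := ht' v w fun h => hvS (h ▸ hw)
      exact Finset.mem_image.2 ⟨y, by simp, hy⟩
    exact_mod_cast this
  set b : ℝ := ((1 - (1 - g / Fintype.card W) * (#S / Fintype.card I) : ℝ) ^ k) ^ #(S ∪ B)ᶜ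
    with hb
  calc _ ≤ 𝔼 x : V → Equiv.Perm I × (Fin k → W),
          ind (∀ v ∈ S.erase u, t v ((x v).1 (a v (j v))) ∈ S) * b := by
        refine Finset.expect_le_expect fun x _ => ?_
        by_cases hx : ∀ v ∈ S.erase u, t v ((x v).1 (a v (j v))) ∈ S
        · rw [ind_of_true hx, one_mul]
          set G := F ∪ (S.erase u).image fun w => (x w).2 (j w) with hG
          have hGg : #G ≤ g := by
            have h1 := Finset.card_union_le F ((S.erase u).image fun w => (x w).2 (j w))
            have h2 := Finset.card_image_le (s := S.erase u) (f := fun w => (x w).2 (j w))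
            have h3 := Finset.card_erase_le (s := S) (a := u)
            rw [hG]
            omega
          refine le_trans (prob_mono (q := fun y => ∀ v ∈ (S ∪ B)ᶜ, ∀ i,
            ¬ (t v ((y v).1 (a v i)) ∈ S ∧ (y v).2 i ∉ G)) fun y hy v hv i => ?_) ?_
          · have h1 := hy.2 v hv i
            have hvS : v ∉ S := fun h => Finset.mem_compl.1 hv (Finset.mem_union_left _ h)
            simp only [hvS, if_false] at h1
            convert h1 using 4
            refine congrArg (F ∪ ·) (Finset.image_congr fun w hw => ?_)
            have hwS : w ∈ S := Finset.mem_of_mem_erase hw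
            simp [hwS]
          · refine prob_forall_mem_le (κ := fun _ : V => Equiv.Perm I × (Fin k → W)) _
              (fun v z => ∀ i, ¬ (t v (z.1 (a v i)) ∈ S ∧ z.2 i ∉ G)) fun v hv => ?_
            have hvS : v ∉ S := fun h => Finset.mem_compl.1 hv (Finset.mem_union_left _ h)
            refine (prob_no_extension_le S (fun w hw => ht' v w fun h => hvS (h ▸ hw)) (a v)
              (ha v) G).trans ?_
            have hSI := hSI v hvS
            have h0 : (#G : ℝ) / Fintype.card W ≤ g / Fintype.card W := by gcongr
            have h0' : (0 : ℝ) ≤ #G / Fintype.card W := by positivity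
            have h1 : (0 : ℝ) ≤ #S / Fintype.card I := by positivity
            refine pow_le_pow_left₀ ?_ ?_ k
            · nlinarith
            · nlinarith
        · rw [ind_of_false hx, zero_mul]
          refine le_of_eq ?_
          rw [prob_congr (q := fun _ => False)]
          · simp [prob]
          · intro y
            refine iff_false_intro fun hy => hx fun v hv => ?_
            have := hy.1 v hv
            simpa [Finset.mem_of_mem_erase hv] using this
    _ ≤ _ := by
        rw [← Finset.expect_mul, ← prob_eq_expect]
        have hb0 : 0 ≤ b := by
          rcases (S ∪ B)ᶜ.eq_empty_or_nonempty with h | ⟨v, hv⟩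
          · simp [hb, h]
          · have hvS : v ∉ S := fun h => Finset.mem_compl.1 hv (Finset.mem_union_left _ h)
            have h1 := hSI v hvS
            have h2 : (0 : ℝ) ≤ #S / Fintype.card I := by positivity
            have h3 : (g : ℝ) / Fintype.card W ≤ 1 :=
              div_le_one_of_le₀ (by exact_mod_cast hgW) hW.le
            have h4 : (0 : ℝ) ≤ g / Fintype.card W := by positivity
            refine pow_nonneg (pow_nonneg ?_ _) _
            nlinarith
        gcongr
        exact prob_forall_mem_le (κ := fun _ : V => Equiv.Perm I × (Fin k → W)) _
          (fun v z => t v (z.1 (a v (j v))) ∈ S) fun v _ =>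
            prob_prod_le' (by positivity) fun _ => prob_perm_tail_le (ht v) S _

/-- With high probability no structure on few vertices is stuck. -/
lemma prob_exists_stuck_le {t : V → I → V} (ht : ∀ v, Injective (t v))
    (ht' : ∀ v w, w ≠ v → ∃ y, t v y = w) {a : V → Fin k → I} (ha : ∀ v, Injective (a v))
    (hI : Fintype.card I + 1 = Fintype.card V) (hI0 : 0 < Fintype.card I)
    (hVW : Fintype.card V ≤ Fintype.card W) {β η : ℝ}
    (hβ0 : 0 ≤ β) (hβ : β ≤ 1 / 10) (hk : 1 ≤ k)
    (hη : Real.exp 1 * k * Real.exp (-(30 * β ^ 2 * k)) ≤ η) (hη2 : η ≤ 1 / 2)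
    (u : V) (B : Finset V) (F : Finset W) (hB : (#B : ℝ) ≤ 2 * β * Fintype.card V)
    (hF : (#F : ℝ) ≤ 3 * β * Fintype.card V) :
    prob (fun ω : V → Equiv.Perm I × (Fin k → W) => ∃ S : Finset V, u ∈ S ∧
      (#S : ℝ) ≤ Fintype.card V - 8 * β * Fintype.card V ∧ ∃ j, Stuck t a u B F ω S j) ≤
      2 * η := by
  set n : ℝ := (Fintype.card V : ℝ) with hn
  have hnI : (Fintype.card I : ℝ) + 1 = n := by rw [hn]; exact_mod_cast hI
  have hI0' : (0 : ℝ) < Fintype.card I := by exact_mod_cast hI0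
  have hn0 : 0 < n := by linarith
  have hnW : n ≤ Fintype.card W := by rw [hn]; exact_mod_cast hVW
  set θ : ℝ := Real.exp 1 * k * Real.exp (-(30 * β ^ 2 * k)) with hθ
  have hk' : (1 : ℝ) ≤ k := by exact_mod_cast hk
  calc _ ≤ prob (fun ω : V → Equiv.Perm I × (Fin k → W) => ∃ Q ⊆ univ.erase u,
        ((#Q + 1 : ℝ) ≤ n - 8 * β * n ∧
          ∃ j ∈ Fintype.piFinset (fun v => if v ∈ Q then univ else {(⟨0, hk⟩ : Fin k)}),
            Stuck t a u B F ω (insert u Q) j)) := by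
        refine prob_mono ?_
        rintro ω ⟨S, huS, hS, j, hj⟩
        refine ⟨S.erase u, Finset.erase_subset_erase _ (Finset.subset_univ _), ?_,
          fun v => if v ∈ S.erase u then j v else ⟨0, hk⟩, ?_, ?_⟩
        · rw [← Finset.card_erase_add_one huS] at hS
          exact_mod_cast hS
        · rw [Fintype.mem_piFinset]
          intro v
          by_cases hv : v ∈ S.erase u <;> simp [hv]
        · rw [Finset.insert_erase huS]
          refine ⟨fun v hv => ?_, fun v hv i => ?_⟩
          · simpa only [if_pos hv] using hj.1 v hv
          · have h := hj.2 v hv i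
            convert h using 4
            refine congrArg (F ∪ ·) (Finset.image_congr fun w hw => ?_)
            simp only [if_pos (Finset.mem_coe.1 hw)]
    _ ≤ ∑ r ∈ range (#(univ.erase u) + 1), (#(univ.erase u)).choose r *
          (k ^ r * (((r + 1) / Fintype.card I) ^ r *
            Real.exp (-(30 * β ^ 2 * k) * (r + 1)))) := by
        refine prob_exists_subset_le (univ.erase u) _ (fun r => (k ^ r *
          (((r + 1) / Fintype.card I) ^ r * Real.exp (-(30 * β ^ 2 * k) * (r + 1)))))
            fun Q hQ => ?_
        have huQ : u ∉ Q := fun h => by simpa using hQ h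
        by_cases hQn : (#Q + 1 : ℝ) ≤ n - 8 * β * n
        · have hcard : #(Fintype.piFinset (fun v => if v ∈ Q then univ else {(⟨0, hk⟩ : Fin k)})) =
              k ^ #Q := by
            rw [Fintype.card_piFinset]
            simp_rw [apply_ite Finset.card]
            simp
          refine (prob_mono fun ω h => h.2).trans ((prob_exists_le _ _).trans ?_)
          rw [← Nat.cast_pow, ← hcard, ← nsmul_eq_mul]
          refine Finset.sum_le_card_nsmul _ _ _ fun j _ => ?_
          have hcS : #(insert u Q) = #Q + 1 := Finset.card_insert_of_notMem huQ
          have hgn : ((#F + (#Q + 1) : ℕ) : ℝ) ≤ (1 - 5 * β) * n := by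
            push_cast; linarith
          have hgW : ((#F + (#Q + 1) : ℕ) : ℝ) ≤ (1 - 5 * β) * Fintype.card W := by
            nlinarith
          refine (prob_stuck_le ht ht' ha u B F (insert u Q) j (#F + (#Q + 1)) (by rw [hcS])
            ?_).trans ?_
          · have : ((#F + (#Q + 1) : ℕ) : ℝ) ≤ Fintype.card W := by nlinarith
            exact_mod_cast this
          · rw [hcS, Finset.erase_insert huQ]
            push_cast
            refine mul_le_mul_of_nonneg_left ?_ (by positivity)
            push_cast at hgW
            have hW0 : (0 : ℝ) < Fintype.card W := hn0.trans_le hnW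
            set y : ℝ := (1 - (#F + (#Q + 1)) / Fintype.card W) * ((#Q + 1) / Fintype.card I)
              with hy
            have hq : (0 : ℝ) < #Q + 1 := by positivity
            have hx : 5 * β ≤ 1 - (#F + (#Q + 1)) / Fintype.card W := by
              have := (div_le_iff₀ hW0).2 hgW
              linarith
            have hx1 : 1 - (#F + (#Q + 1)) / Fintype.card W ≤ (1 : ℝ) := by
              have : (0 : ℝ) ≤ (#F + (#Q + 1)) / Fintype.card W := by positivity
              linarith
            have hout : 6 * β * n ≤ #(insert u Q ∪ B)ᶜ := by
              have h1 := Finset.card_union_le (insert u Q) B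
              have h2 := Finset.card_add_card_compl (insert u Q ∪ B)
              have h3 : Fintype.card V ≤ #Q + 1 + #B + #(insert u Q ∪ B)ᶜ := by omega
              have h4 : n ≤ #Q + 1 + #B + #(insert u Q ∪ B)ᶜ := by
                rw [hn]; exact_mod_cast h3
              linarith
            rcases Nat.eq_zero_or_pos #(insert u Q ∪ B)ᶜ with h0 | h0
            · rw [h0, Nat.cast_zero] at hout
              have : β = 0 := by nlinarith
              rw [h0, this]; simp
            · have hqI : (#Q + 1 : ℝ) ≤ Fintype.card I := by
                have h1 := Finset.card_add_card_compl (insert u Q ∪ B)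
                have h2 := Finset.card_le_card
                  (Finset.subset_union_left : insert u Q ⊆ insert u Q ∪ B)
                have h3 : #Q + 1 ≤ Fintype.card I := by omega
                exact_mod_cast h3
              have hy1 : y ≤ 1 := by
                have := div_le_one_of_le₀ hqI hI0'.le
                have h0 : (0 : ℝ) ≤ (#Q + 1) / Fintype.card I := by positivity
                rw [hy]; nlinarith
              calc ((1 - y) ^ k) ^ #(insert u Q ∪ B)ᶜ
                  ≤ (Real.exp (-y) ^ k) ^ #(insert u Q ∪ B)ᶜ := by
                    have := sub_nonneg.2 hy1
                    gcongr
                    exact Real.one_sub_le_exp_neg y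
                _ = Real.exp (-(y * (k * #(insert u Q ∪ B)ᶜ))) := by
                    rw [← Real.exp_nat_mul, ← Real.exp_nat_mul]
                    congr 1; ring
                _ ≤ _ := by
                    rw [Real.exp_le_exp, neg_mul, neg_le_neg_iff]
                    have hyl : 5 * β * ((#Q + 1) / n) ≤ y := by
                      rw [hy]
                      gcongr
                      · exact le_trans (by positivity) hx
                      · rw [← hnI]; linarith
                    calc 30 * β ^ 2 * k * (#Q + 1)
                        = 5 * β * ((#Q + 1) / n) * (k * (6 * β * n)) := by
                          field_simp; ring
                      _ ≤ _ := by
                          have : 0 ≤ y := le_trans (by positivity) hyl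
                          gcongr
        · rw [prob_congr (q := fun _ => False) (fun ω => by simp [hQn])]
          simp only [prob, Nat.card_of_isEmpty, Nat.cast_zero, zero_div]
          positivity
    _ ≤ ∑ s ∈ Icc 1 (#(univ.erase u) + 1), θ ^ s := by
        have h1 : ∑ s ∈ Icc 1 (#(univ.erase u) + 1), θ ^ s =
            ∑ r ∈ range (#(univ.erase u) + 1), θ ^ (r + 1) := by
          rw [Finset.range_eq_Ico, Finset.sum_Ico_add' (fun s => θ ^ s) 0 _ 1]
          rfl
        rw [h1]
        refine Finset.sum_le_sum fun r _ => ?_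
        have h2 : #(univ.erase u) = Fintype.card I := by
          rw [Finset.card_erase_of_mem (Finset.mem_univ u), Finset.card_univ]; omega
        rw [h2]
        have h3 : ((Fintype.card I).choose r : ℝ) ≤ Fintype.card I ^ r / r.factorial :=
          Nat.choose_le_pow_div r _
        have h4 : ((r : ℝ) + 1) ^ r / r.factorial ≤ Real.exp (r + 1) :=
          Real.pow_div_factorial_le_exp _ (by positivity) r
        have h5 : Real.exp ((r : ℝ) + 1) = Real.exp 1 ^ (r + 1) := by
          rw [← Real.exp_nat_mul]; push_cast; rw [mul_one]
        have h6 : Real.exp (-(30 * β ^ 2 * k) * (r + 1)) =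
            Real.exp (-(30 * β ^ 2 * k)) ^ (r + 1) := by
          rw [← Real.exp_nat_mul]; push_cast; rw [mul_comm]
        calc _ ≤ (Fintype.card I : ℝ) ^ r / r.factorial * (k ^ r * (((r + 1) / Fintype.card I) ^ r *
                Real.exp (-(30 * β ^ 2 * k) * (r + 1)))) := by gcongr
          _ = ((r + 1) ^ r / r.factorial) * k ^ r * Real.exp (-(30 * β ^ 2 * k) * (r + 1)) := by
              rw [div_pow]; field_simp
          _ ≤ Real.exp (r + 1) * k ^ (r + 1) * Real.exp (-(30 * β ^ 2 * k) * (r + 1)) := by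
              gcongr
              exact Nat.le_succ r
          _ = θ ^ (r + 1) := by rw [h5, h6, hθ, mul_pow, mul_pow]
    _ ≤ 2 * θ := sum_Icc_pow_le (by positivity) (hη.trans hη2) _
    _ ≤ 2 * η := by linarith

end Growth

section Resampling

open Finset Function
open scoped Classical BigOperators

set_option linter.unusedSectionVars false

variable {V I : Type*} [Fintype V] [DecidableEq V] [Fintype I] [DecidableEq I] {k : ℕ}

/-- Swap the value of `π v` at the selected index `i v` with the one at `y v`, for all `v ∈ X`;
here `X` and `i` only depend on the values of `π` at the indices `a v j`. -/
def resample (a : V → Fin k → I) (X : (V → Fin k → I) → Finset V) (i : (V → Fin k → I) → V → I) :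
    (V → Equiv.Perm I) × (∀ v, {y // y ∉ univ.image (a v)}) →
      (V → Equiv.Perm I) × (∀ v, {y // y ∉ univ.image (a v)}) :=
  fun x => (fun v => if v ∈ X (fun w j => x.1 w (a w j)) ∧
      i (fun w j => x.1 w (a w j)) v ∉ univ.image (a v) then
    x.1 v * Equiv.swap (i (fun w j => x.1 w (a w j)) v) (x.2 v) else x.1 v, x.2)

lemma resample_apply (a : V → Fin k → I) (X : (V → Fin k → I) → Finset V)
    (i : (V → Fin k → I) → V → I)
    (x : (V → Equiv.Perm I) × (∀ v, {y // y ∉ univ.image (a v)})) :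
    (fun v j => (resample a X i x).1 v (a v j)) = fun v j => x.1 v (a v j) := by
  funext v j
  simp only [resample]
  split_ifs with h
  · have h1 : a v j ≠ i (fun w j => x.1 w (a w j)) v := fun e => h.2 (by simp [← e])
    have h2 : a v j ≠ x.2 v := fun e => (x.2 v).2 (by simp [← e])
    simp [Equiv.swap_apply_of_ne_of_ne h1 h2]
  · rfl

lemma resample_involutive (a : V → Fin k → I) (X : (V → Fin k → I) → Finset V)
    (i : (V → Fin k → I) → V → I) : Involutive (resample a X i) := by
  intro x
  have h := resample_apply a X i x
  refine Prod.ext ?_ rfl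
  funext v
  conv_lhs => rw [resample]
  simp only [h]
  by_cases hv : v ∈ X (fun w j => x.1 w (a w j)) ∧
      i (fun w j => x.1 w (a w j)) v ∉ univ.image (a v)
  · rw [if_pos hv]
    simp only [resample]
    rw [if_pos hv]
    simp [mul_assoc]
  · rw [if_neg hv]
    simp only [resample]
    rw [if_neg hv]

lemma prob_exists_closed_le {t : V → I → V} (ht : ∀ v, Injective (t v)) {a : V → Fin k → I}
    (ha : ∀ v, Injective (a v)) (hk : k < Fintype.card I) (x : ℕ)
    (X : (V → Fin k → I) → Finset V) (i : (V → Fin k → I) → V → I) (good : (V → Fin k → I) → Prop)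
    (hX : ∀ τ, good τ → #(X τ) ≤ x)
    (hi : ∀ τ, good τ → ∀ v ∈ X τ, i τ v ∉ univ.image (a v))
    {η : ℝ} (hη : Real.exp 1 * x ≤ η * (Fintype.card I - k)) (hη0 : 0 ≤ η) (hη2 : η ≤ 1 / 2) :
    prob (fun π : V → Equiv.Perm I => good (fun v j => π v (a v j)) ∧
      ∃ Q ⊆ X (fun v j => π v (a v j)), Q.Nonempty ∧
        ∀ v ∈ Q, t v (π v (i (fun v j => π v (a v j)) v)) ∈ Q) ≤ 2 * η := by
  have hcard : ∀ v, Fintype.card {y // y ∉ univ.image (a v)} = Fintype.card I - k := by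
    intro v
    rw [Fintype.card_subtype_compl]
    congr 1
    rw [Fintype.card_subtype, Finset.filter_mem_eq_inter, Finset.univ_inter,
      Finset.card_image_of_injective _ (ha v), Finset.card_univ, Fintype.card_fin]
  have hne : ∀ v, Nonempty {y // y ∉ univ.image (a v)} := fun v =>
    Fintype.card_pos_iff.1 (by rw [hcard]; omega)
  have hpos : (0 : ℝ) < Fintype.card I - k := by
    rw [sub_pos]; exact_mod_cast hk
  refine prob_le_of_resample (resample_involutive a X i).toPerm (by positivity) fun π => ?_
  set τ : V → Fin k → I := fun v j => π v (a v j) with hτ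
  by_cases hg : good τ
  · calc _ ≤ prob (fun y : ∀ v, {y // y ∉ univ.image (a v)} => ∃ Q ⊆ X τ, Q.Nonempty ∧
          #Q ≤ #(X τ) ∧ ∀ v ∈ Q, t v (π v (y v)) ∈ Q) := by
          refine prob_mono ?_
          rintro y ⟨-, Q, hQ, hQne, h⟩
          have hr := resample_apply a X i (π, y)
          simp only [Involutive.coe_toPerm] at hQ h
          rw [hr] at hQ h
          refine ⟨Q, hQ, hQne, Finset.card_le_card hQ, fun v hv => ?_⟩
          have := h v hv
          have hv' := hi τ hg v (hQ hv)
          simp only [resample] at this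
          rw [if_pos ⟨hQ hv, hv'⟩] at this
          simpa using this
      _ ≤ ∑ s ∈ Icc 1 #(X τ), (#(X τ)).choose s * (s * (Fintype.card I - k : ℝ)⁻¹) ^ s := by
          refine prob_exists_card_le (X τ) _
            (fun s => (s * (Fintype.card I - k : ℝ)⁻¹) ^ s) _ fun Q hQ _ _ => ?_
          refine prob_forall_mem_le (κ := fun v => {y // y ∉ univ.image (a v)}) Q
            (fun v y => t v (π v y) ∈ Q) fun v _ => ?_
          have h := prob_mem_subtype_le ({y | t v (π v y) ∈ Q} : Finset I)
            (fun y => y ∉ univ.image (a v))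
          rw [hcard, Nat.cast_sub hk.le] at h
          simp only [Finset.mem_filter, Finset.mem_univ, true_and] at h
          refine h.trans ?_
          rw [div_eq_mul_inv]
          gcongr
          exact card_filter_mem_le ((ht v).comp (π v).injective) Q
      _ ≤ ∑ s ∈ Icc 1 #(X τ), η ^ s := by
          refine Finset.sum_le_sum fun s _ => ?_
          refine (choose_mul_pow_le _ _ (by positivity)).trans ?_
          have hx : (#(X τ) : ℝ) ≤ x := by exact_mod_cast hX τ hg
          gcongr
          rw [← div_eq_mul_inv, div_le_iff₀ hpos]
          refine le_trans ?_ hη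
          gcongr
      _ ≤ 2 * η := sum_Icc_pow_le hη0 hη2 _
  · rw [prob_congr (q := fun _ => False)]
    · simp [prob]; exact hη0
    · intro y
      refine iff_false_intro fun h => hg ?_
      have hr := resample_apply a X i (π, y)
      have h1 := h.1
      simp only [Involutive.coe_toPerm] at h1
      rwa [hr] at h1

end Resampling

section Matching

open Finset Function
open scoped Classical

set_option linter.unusedSectionVars false

lemma exists_injOn_of_card_le_biUnion {V W : Type*} [Nonempty W] (R : Finset V)
    (N : V → Finset W) (h : ∀ Q ⊆ R, Q.Nonempty → #Q ≤ #(Q.biUnion N)) :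
    ∃ f : V → W, (∀ v ∈ R, f v ∈ N v) ∧ Set.InjOn f R := by
  obtain ⟨f, hf, hfN⟩ := (Finset.all_card_le_biUnion_card_iff_exists_injective
    (fun v : R => N v)).1 fun Q => by
      rcases Q.eq_empty_or_nonempty with rfl | hQ
      · simp
      · have := h (Q.image Subtype.val) (fun v hv => by
          obtain ⟨w, _, rfl⟩ := Finset.mem_image.1 hv; exact w.2) (hQ.image _)
        rwa [Finset.card_image_of_injective _ Subtype.val_injective, Finset.image_biUnion] at this
  refine ⟨fun v => if hv : v ∈ R then f ⟨v, hv⟩ else Classical.arbitrary W, fun v hv => ?_, ?_⟩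
  · simpa [hv] using hfN ⟨v, hv⟩
  · intro v hv w hw hvw
    have hv' : v ∈ R := hv
    have hw' : w ∈ R := hw
    simp only [hv', hw', dif_pos] at hvw
    exact congrArg Subtype.val (hf hvw)

variable {V W : Type*} [Fintype V] [DecidableEq V] [Fintype W] {k : ℕ}

lemma exists_matching_of_not_trapped (hk : 0 < k) (F : Finset W) (L : ℕ)
    (hVW : Fintype.card V ≤ Fintype.card W) (c : V → Fin k → W)
    (h : ¬ ∃ Q : Finset V, Q.Nonempty ∧ #Q ≤ L ∧ ∃ Y ⊆ (univ : Finset W), #Y = #Q ∧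
      ∀ v ∈ Q, ∀ i, c v i ∈ F ∪ Y) (D : Finset V) (hD : #D ≤ L) :
    ∃ d : V → Fin k, (∀ v ∈ D, c v (d v) ∉ F) ∧ Set.InjOn (fun v => c v (d v)) D := by
  rcases D.eq_empty_or_nonempty with rfl | ⟨v₀, hv₀⟩
  · exact ⟨fun _ => ⟨0, hk⟩, by simp, by simp⟩
  have : Nonempty W := ⟨c v₀ ⟨0, hk⟩⟩
  have : Nonempty (Fin k) := ⟨⟨0, hk⟩⟩
  obtain ⟨f, hf, hinj⟩ := exists_injOn_of_card_le_biUnion D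
    (fun v => (univ.image (c v)) \ F) fun Q hQ hne => by
      by_contra! hlt
      refine h ⟨Q, hne, (Finset.card_le_card hQ).trans hD, ?_⟩
      obtain ⟨Y, hY, -, hYc⟩ := Finset.exists_subsuperset_card_eq
        (Finset.subset_univ (Q.biUnion fun v => (univ.image (c v)) \ F)) hlt.le
        ((Finset.card_le_univ Q).trans hVW)
      refine ⟨Y, Finset.subset_univ _, hYc, fun v hv i => ?_⟩
      by_cases hi : c v i ∈ F
      · exact Finset.mem_union_left _ hi
      · exact Finset.mem_union_right _ (hY (Finset.mem_biUnion.2 ⟨v, hv, by simp [hi]⟩))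
  have hf' : ∀ v ∈ D, ∃ i, c v i = f v := fun v hv => by
    have := hf v hv
    simp at this
    exact this.1
  choose! d hd using hf'
  refine ⟨d, fun v hv => ?_, fun v hv w hw hvw => hinj hv hw ?_⟩
  · rw [hd v hv]
    exact (Finset.mem_sdiff.1 (hf v hv)).2
  · simpa only [hd v hv, hd w hw] using hvw

lemma exists_matching_of_hall (hk : 0 < k) [Nonempty W] (W₀ A : Finset W) (hW₀ : W₀ ⊆ A)
    (L b : ℕ) (hL : L ≤ #W₀) (c : V → Fin k → W) (R : Finset V)
    (hR : ∀ v ∈ R, 3 ≤ #{i | c v i ∈ W₀}) (hRA : #R + b ≤ #A)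
    (hsmall : ¬ ∃ Q : Finset V, Q.Nonempty ∧ #Q ≤ L ∧
      ∃ Y ⊆ W₀, #Y = #Q ∧ ∀ v ∈ Q, 3 ≤ #{i | c v i ∈ W₀} ∧ ∀ i, c v i ∈ W₀ → c v i ∈ Y)
    (hlarge : ¬ ∃ Q : Finset V, L ≤ #Q ∧ ∃ Y : Finset W, b ≤ #Y ∧ ∀ v ∈ Q, ∀ i, c v i ∉ Y) :
    ∃ d : V → Fin k, (∀ v ∈ R, c v (d v) ∈ A) ∧ Set.InjOn (fun v => c v (d v)) R := by
  have : Nonempty (Fin k) := ⟨⟨0, hk⟩⟩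
  obtain ⟨f, hf, hinj⟩ := exists_injOn_of_card_le_biUnion R
    (fun v => (univ.image (c v)) ∩ A) fun Q hQ hne => by
      by_contra! hlt
      set N := Q.biUnion fun v => (univ.image (c v)) ∩ A with hN
      have hmem : ∀ v ∈ Q, ∀ i, c v i ∈ A → c v i ∈ N := fun v hv i hi =>
        Finset.mem_biUnion.2 ⟨v, hv, by simp [hi]⟩
      rcases le_or_gt #Q L with hQL | hQL
      · obtain ⟨Y, hY, hYW, hYc⟩ := Finset.exists_subsuperset_card_eq
          (Finset.inter_subset_right : N ∩ W₀ ⊆ W₀)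
          ((Finset.card_le_card Finset.inter_subset_left).trans hlt.le) (hQL.trans hL)
        exact hsmall ⟨Q, hne, hQL, Y, hYW, hYc, fun v hv => ⟨hR v (hQ hv), fun i hi =>
          hY (Finset.mem_inter.2 ⟨hmem v hv i (hW₀ hi), hi⟩)⟩⟩
      · refine hlarge ⟨Q, hQL.le, A \ N, ?_, fun v hv i hi => ?_⟩
        · have h1 := Finset.le_card_sdiff N A
          have h2 := Finset.card_le_card hQ
          omega
        · obtain ⟨hiA, hiN⟩ := Finset.mem_sdiff.1 hi
          exact hiN (hmem v hv i hiA)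
  have hf' : ∀ v ∈ R, ∃ i, c v i = f v := fun v hv => by
    have := hf v hv
    simp at this
    exact this.1
  choose! d hd using hf'
  refine ⟨d, fun v hv => ?_, fun v hv w hw hvw => hinj hv hw ?_⟩
  · rw [hd v hv]
    exact (Finset.mem_inter.1 (hf v hv)).2
  · simpa only [hd v hv, hd w hw] using hvw

/-- A maximal rainbow structure grown from the root is stuck. -/
lemma exists_stuck {I : Type*} [Fintype I] [DecidableEq I] (hk : 0 < k) (t : V → I → V)
    (a : V → Fin k → I) (u : V) (B : Finset V) (hu : u ∉ B) (F : Finset W)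
    (ω : V → Equiv.Perm I × (Fin k → W)) :
    ∃ (S : Finset V) (j : V → Fin k), u ∈ S ∧ Disjoint S B ∧
      (∀ v ∈ S.erase u, (ω v).2 (j v) ∉ F) ∧
      Set.InjOn (fun v => (ω v).2 (j v)) (S.erase u) ∧
      (∀ Q ⊆ S.erase u, Q.Nonempty → ∃ v ∈ Q, t v ((ω v).1 (a v (j v))) ∉ Q) ∧
      Stuck t a u B F ω S j := by
  let P : Finset V → (V → Fin k) → Prop := fun S j => u ∈ S ∧ Disjoint S B ∧
    (∀ v ∈ S.erase u, (ω v).2 (j v) ∉ F) ∧ Set.InjOn (fun v => (ω v).2 (j v)) (S.erase u) ∧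
    (∀ Q ⊆ S.erase u, Q.Nonempty → ∃ v ∈ Q, t v ((ω v).1 (a v (j v))) ∉ Q) ∧
    ∀ v ∈ S.erase u, t v ((ω v).1 (a v (j v))) ∈ S
  have hne : (univ.filter fun S => ∃ j, P S j).Nonempty := by
    refine ⟨{u}, Finset.mem_filter.2 ⟨Finset.mem_univ _, fun _ => ⟨0, hk⟩, ?_⟩⟩
    refine ⟨by simp, by simpa using hu, by simp, by simp, fun Q hQ hQne => ?_, by simp⟩
    exact absurd (Finset.subset_empty.1 (by simpa using hQ)) hQne.ne_empty
  obtain ⟨S, hS, hmax⟩ := Finset.exists_max_image _ (fun S => #S) hne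
  obtain ⟨-, j, huS, hSB, hF, hinj, hacy, hpar⟩ := Finset.mem_filter.1 hS
  refine ⟨S, j, huS, hSB, hF, hinj, hacy, hpar, ?_⟩
  rintro v hv i ⟨hvS', hc⟩
  obtain ⟨hvS, hvB⟩ : v ∉ S ∧ v ∉ B := by simpa using hv
  have hvu : v ≠ u := fun h => hvS (h ▸ huS)
  obtain ⟨hcF, hcI⟩ : (ω v).2 i ∉ F ∧ (ω v).2 i ∉ (S.erase u).image fun w => (ω w).2 (j w) := by
    rwa [Finset.mem_union, not_or] at hc
  have hins : (insert v S).erase u = insert v (S.erase u) := Finset.erase_insert_of_ne hvu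
  have hup : ∀ w ∈ S.erase u, update j v i w = j w := fun w hw =>
    update_of_ne (by rintro rfl; exact hvS (Finset.mem_of_mem_erase hw)) _ _
  have hP : P (insert v S) (update j v i) := by
    refine ⟨Finset.mem_insert_of_mem huS, Finset.disjoint_insert_left.2 ⟨hvB, hSB⟩, ?_, ?_, ?_, ?_⟩
    · rw [hins]
      intro w hw
      rcases Finset.mem_insert.1 hw with rfl | hw
      · simpa using hcF
      · rw [hup w hw]; exact hF w hw
    · rw [hins, Finset.coe_insert]
      refine (Set.injOn_insert (by simp [hvS])).2 ⟨?_, ?_⟩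
      · intro w hw w' hw' h
        simp only [hup w hw, hup w' hw'] at h
        exact hinj hw hw' h
      · rintro ⟨w, hw, h⟩
        simp only [hup w hw, update_self] at h
        exact hcI (Finset.mem_image.2 ⟨w, hw, h⟩)
    · rw [hins]
      intro Q hQ hQne
      rcases (Q.erase v).eq_empty_or_nonempty with h0 | h0
      · have hQv : Q = {v} := by
          rcases (Finset.erase_eq_empty_iff Q v).1 h0 with h | h
          · exact absurd h hQne.ne_empty
          · exact h
        refine ⟨v, by simp [hQv], ?_⟩
        simp only [update_self, hQv, Finset.mem_singleton]
        exact fun h => hvS (h ▸ hvS')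
      · have hsub : Q.erase v ⊆ S.erase u := by
          intro w hw
          exact (Finset.mem_insert.1 (hQ (Finset.mem_of_mem_erase hw))).resolve_left
            (Finset.ne_of_mem_erase hw)
        obtain ⟨w, hw, hwQ⟩ := hacy _ hsub h0
        refine ⟨w, Finset.mem_of_mem_erase hw, ?_⟩
        rw [hup w (hsub hw)]
        intro h
        refine hwQ (Finset.mem_erase.2 ⟨fun e => hvS ?_, h⟩)
        rw [← e]; exact hpar w (hsub hw)
    · rw [hins]
      intro w hw
      rcases Finset.mem_insert.1 hw with rfl | hw
      · simpa using Finset.mem_insert_of_mem hvS'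
      · rw [hup w hw]; exact Finset.mem_insert_of_mem (hpar w hw)
  have h1 := hmax (insert v S) (Finset.mem_filter.2 ⟨Finset.mem_univ _, _, hP⟩)
  simp only [Finset.card_insert_of_notMem hvS] at h1
  omega

end Matching

/-- The slots at a vertex: one slot for the vertices of small in-degree, and three blocks of
`k` slots used for growing a tree, for matching most of the remaining vertices, and for
matching the vertices which see too few reserved colours. -/
abbrev Slot (k : ℕ) := Unit ⊕ (Fin k ⊕ (Fin k ⊕ Fin k))

/-- Numerical conditions on the parameters of the construction. -/
structure Admissible (β : ℝ) (n w k : ℕ) : Prop where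
  pos : 0 < β
  le : β ≤ 1 / 100
  four_le : 4 ≤ β * n
  le_w : n ≤ w
  k_pos : 1 ≤ k
  k_le : 2 * ((k : ℝ) + 1) ≤ n
  w_le : w ≤ 2 * n
  few : 4 * (1 - β / 4) ^ k ≤ β ^ 2
  trapped : n * w * (4 * β) ^ k ≤ β
  large : (2 : ℝ) ^ n * 2 ^ w * Real.exp (-((w - n : ℕ) / w) * (k * ⌊β ^ 3 / 9 * n⌋₊)) ≤ β
  stuck : Real.exp 1 * k * Real.exp (-(30 * β ^ 2 * k)) ≤ β

section Selection

open Finset Function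
open scoped Classical

set_option linter.unusedSectionVars false

variable {V I W : Type*} [Fintype V] [DecidableEq V] [Fintype I] [DecidableEq I] [Fintype W]
  [Nonempty W] {k : ℕ}

/-- A set of `m` colours disjoint from `C`, if there is one. -/
noncomputable def reserved (m : ℕ) (C : Finset W) : Finset W :=
  if h : ∃ T ⊆ Cᶜ, #T = m then h.choose else ∅

lemma reserved_spec {m : ℕ} {C : Finset W} (h : #C + m ≤ Fintype.card W) :
    reserved m C ⊆ Cᶜ ∧ #(reserved m C) = m := by
  have h' : ∃ T ⊆ Cᶜ, #T = m := Finset.exists_subset_card_eq (by rw [Finset.card_compl]; omega)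
  rw [reserved, dif_pos h']
  exact h'.choose_spec

/-- The vertices which are neither small nor the root and see at most two reserved colours. -/
noncomputable def dangerous (u : V) (Sm : Finset V) (W₀ : Finset W) (c : V → Fin k → W) :
    Finset V :=
  {v ∈ (insert u Sm)ᶜ | #{i | c v i ∈ W₀} ≤ 2}

/-- The typical behaviour of the colours of the small slots and of the second and third block. -/
structure Nice (β : ℝ) (u : V) (Sm : Finset V)
    (x : (V → W) × (V → Fin k → W) × (V → Fin k → W)) (W₀ : Finset W) : Prop where
  inj : Set.InjOn x.1 Sm
  few : ¬ β * Fintype.card V < #(dangerous u Sm W₀ x.2.1)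
  trapped : ¬ ∃ Q : Finset V, Q.Nonempty ∧ #Q ≤ ⌊β * Fintype.card V⌋₊ ∧
    ∃ Y ⊆ (univ : Finset W), #Y = #Q ∧ ∀ v ∈ Q, ∀ i, x.2.2 v i ∈ (W₀ ∪ Sm.image x.1) ∪ Y
  small : ¬ ∃ Q : Finset V, Q.Nonempty ∧ #Q ≤ ⌊β ^ 3 / 9 * Fintype.card V⌋₊ ∧
    ∃ Y ⊆ W₀, #Y = #Q ∧
      ∀ v ∈ Q, 3 ≤ #{i | x.2.1 v i ∈ W₀} ∧ ∀ i, x.2.1 v i ∈ W₀ → x.2.1 v i ∈ Y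
  large : ¬ ∃ Q : Finset V, ⌊β ^ 3 / 9 * Fintype.card V⌋₊ ≤ #Q ∧
    ∃ Y : Finset W, Fintype.card W - Fintype.card V ≤ #Y ∧ ∀ v ∈ Q, ∀ i, x.2.1 v i ∉ Y

variable {β : ℝ}

lemma card_small_le (hp : Admissible β (Fintype.card V) (Fintype.card W) k) {Sm : Finset V}
    (hSm : (#Sm : ℝ) ^ 2 ≤ β * Fintype.card V) : (#Sm : ℝ) ≤ β * Fintype.card V / 2 := by
  have := hp.four_le
  by_contra! h
  nlinarith

lemma reserved_image_spec (hp : Admissible β (Fintype.card V) (Fintype.card W) k) {Sm : Finset V}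
    (hSm : (#Sm : ℝ) ^ 2 ≤ β * Fintype.card V) (c : V → W) :
    reserved ⌈β * Fintype.card V⌉₊ (Sm.image c) ⊆ (Sm.image c)ᶜ ∧
      #(reserved ⌈β * Fintype.card V⌉₊ (Sm.image c)) = ⌈β * Fintype.card V⌉₊ := by
  have h4 := hp.four_le
  refine reserved_spec ?_
  have h1 := card_small_le hp hSm
  have h2 : (#(Sm.image c) : ℝ) ≤ #Sm := by exact_mod_cast Finset.card_image_le
  have h3 := Nat.ceil_lt_add_one (show 0 ≤ β * Fintype.card V by linarith)
  have h5 : (Fintype.card V : ℝ) ≤ Fintype.card W := by exact_mod_cast hp.le_w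
  have h6 := hp.le
  have : ((#(Sm.image c) + ⌈β * Fintype.card V⌉₊ : ℕ) : ℝ) ≤ Fintype.card W := by
    push_cast
    nlinarith
  exact_mod_cast this

lemma card_pos_of_admissible (hp : Admissible β (Fintype.card V) (Fintype.card W) k) :
    (0 : ℝ) < Fintype.card V ∧ (0 : ℝ) < Fintype.card W := by
  have h1 := hp.pos
  have h4 := hp.four_le
  have h5 : (Fintype.card V : ℝ) ≤ Fintype.card W := by exact_mod_cast hp.le_w
  constructor <;> nlinarith

lemma prob_small_not_injOn_le (hp : Admissible β (Fintype.card V) (Fintype.card W) k)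
    {Sm : Finset V} (hSm : (#Sm : ℝ) ^ 2 ≤ β * Fintype.card V) :
    prob (fun c : V → W => ¬ Set.InjOn c Sm) ≤ β := by
  refine (prob_not_injOn_le Sm).trans ?_
  have h5 : (Fintype.card V : ℝ) ≤ Fintype.card W := by exact_mod_cast hp.le_w
  have := hp.pos
  rw [div_le_iff₀ (card_pos_of_admissible hp).2]
  nlinarith

lemma prob_dangerous_le (hp : Admissible β (Fintype.card V) (Fintype.card W) k) {W₀ : Finset W}
    (hcard : #W₀ = ⌈β * Fintype.card V⌉₊) (u : V) (Sm : Finset V) :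
    prob (fun c : V → Fin k → W => β * Fintype.card V < #(dangerous u Sm W₀ c)) ≤ β := by
  have hβ := hp.pos
  have hβ1 := hp.le
  obtain ⟨hn0, hw0⟩ := card_pos_of_admissible hp
  have hwn : (Fintype.card W : ℝ) ≤ 2 * Fintype.card V := by exact_mod_cast hp.w_le
  have hc0 := Nat.le_ceil (β * Fintype.card V)
  refine (prob_many_le (insert u Sm)ᶜ (fun c : Fin k → W => #{i | c i ∈ W₀} ≤ 2)
    (by positivity) (prob_card_mem_le_two W₀ (p := β / 2) ?_ (by linarith))).trans ?_
  · rw [hcard, le_div_iff₀ hw0]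
    nlinarith
  · rw [div_le_iff₀ (by positivity)]
    have h1 := hp.few
    have h2 : (#(insert u Sm)ᶜ : ℝ) ≤ Fintype.card V := by
      exact_mod_cast Finset.card_le_univ _
    have h3 : (0 : ℝ) ≤ 4 * (1 - β / 4) ^ k := by
      have : 0 ≤ 1 - β / 4 := by linarith
      positivity
    have h5 : (1 - β / 2 / 2) = 1 - β / 4 := by ring
    rw [h5]
    calc _ ≤ Fintype.card V * β ^ 2 := by gcongr
      _ = _ := by ring

lemma prob_reserved_trapped_le (hp : Admissible β (Fintype.card V) (Fintype.card W) k)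
    {W₀ C : Finset W} (hcard : #W₀ = ⌈β * Fintype.card V⌉₊)
    (hC : (#C : ℝ) ≤ β * Fintype.card V / 2) :
    prob (fun c : V → Fin k → W =>
      ∃ Q : Finset V, Q.Nonempty ∧ #Q ≤ ⌊β * Fintype.card V⌋₊ ∧ ∃ Y ⊆ (univ : Finset W),
        #Y = #Q ∧ ∀ v ∈ Q, ∀ i, c v i ∈ (W₀ ∪ C) ∪ Y) ≤ 2 * β := by
  have hβ := hp.pos
  have hβ1 := hp.le
  have h4 := hp.four_le
  obtain ⟨hn0, hw0⟩ := card_pos_of_admissible hp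
  have hnw : (Fintype.card V : ℝ) ≤ Fintype.card W := by exact_mod_cast hp.le_w
  have hc1 := Nat.ceil_lt_add_one (show 0 ≤ β * Fintype.card V by positivity)
  have ht := hp.trapped
  refine (prob_trapped_le (W₀ ∪ C) ⌊β * Fintype.card V⌋₊ (a := 4 * β) (by positivity) ?_
    (ht.trans (by linarith))).trans (by linarith)
  have h1 : (#(W₀ ∪ C) : ℝ) ≤ ⌈β * Fintype.card V⌉₊ + #C := by
    rw [← hcard]
    exact_mod_cast Finset.card_union_le _ _
  have h2 := Nat.floor_le (show 0 ≤ β * Fintype.card V by positivity)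
  nlinarith

lemma floor_le_card_reserved (hp : Admissible β (Fintype.card V) (Fintype.card W) k)
    {W₀ : Finset W} (hcard : #W₀ = ⌈β * Fintype.card V⌉₊) :
    ⌊β ^ 3 / 9 * Fintype.card V⌋₊ ≤ #W₀ := by
  have hβ := hp.pos
  have hβ1 := hp.le
  obtain ⟨hn0, hw0⟩ := card_pos_of_admissible hp
  rw [hcard]
  refine (Nat.floor_le_ceil _).trans (Nat.ceil_mono ?_)
  have : β ^ 3 ≤ β := by
    calc β ^ 3 ≤ β ^ 1 := pow_le_pow_of_le_one hβ.le (by linarith) (by norm_num)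
      _ = β := pow_one β
  nlinarith

lemma prob_reserved_hall_small_le (hp : Admissible β (Fintype.card V) (Fintype.card W) k)
    {W₀ : Finset W} (hcard : #W₀ = ⌈β * Fintype.card V⌉₊) :
    prob (fun c : V → Fin k → W =>
      ∃ Q : Finset V, Q.Nonempty ∧ #Q ≤ ⌊β ^ 3 / 9 * Fintype.card V⌋₊ ∧ ∃ Y ⊆ W₀, #Y = #Q ∧
        ∀ v ∈ Q, 3 ≤ #{i | c v i ∈ W₀} ∧ ∀ i, c v i ∈ W₀ → c v i ∈ Y) ≤ 2 * β := by
  have hβ := hp.pos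
  have hβ1 := hp.le
  obtain ⟨hn0, hw0⟩ := card_pos_of_admissible hp
  have hc0 := Nat.le_ceil (β * Fintype.card V)
  have h2 := Nat.floor_le (show 0 ≤ β ^ 3 / 9 * Fintype.card V by positivity)
  refine prob_hall_small_le W₀ _ (floor_le_card_reserved hp hcard) ?_ hβ.le (by linarith)
  rw [hcard]
  calc 9 * Fintype.card V * (⌊β ^ 3 / 9 * Fintype.card V⌋₊ : ℝ)
      ≤ 9 * Fintype.card V * (β ^ 3 / 9 * Fintype.card V) := by gcongr
    _ = β * (β * Fintype.card V) ^ 2 := by ring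
    _ ≤ _ := by gcongr

lemma prob_not_nice_le (hp : Admissible β (Fintype.card V) (Fintype.card W) k) (u : V)
    (Sm : Finset V) (hSm : (#Sm : ℝ) ^ 2 ≤ β * Fintype.card V) :
    prob (fun x : (V → W) × (V → Fin k → W) × (V → Fin k → W) =>
      ¬ Nice β u Sm x (reserved ⌈β * Fintype.card V⌉₊ (Sm.image x.1))) ≤ 7 * β := by
  have hβ := hp.pos
  obtain ⟨R, hR'⟩ : ∃ R : (V → W) → Finset W,
      R = fun cS => reserved ⌈β * Fintype.card V⌉₊ (Sm.image cS) := ⟨_, rfl⟩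
  have hR : ∀ cS, #(R cS) = ⌈β * Fintype.card V⌉₊ := fun cS => by
    rw [hR']; exact (reserved_image_spec hp hSm cS).2
  have hA : prob (fun x : (V → W) × (V → Fin k → W) × (V → Fin k → W) =>
      ¬ Set.InjOn x.1 Sm) ≤ β :=
    prob_prod_le' (p := fun x : (V → W) × (V → Fin k → W) × (V → Fin k → W) =>
      ¬ Set.InjOn x.1 Sm) hβ.le fun _ => prob_small_not_injOn_le hp hSm
  have hB : prob (fun x : (V → W) × (V → Fin k → W) × (V → Fin k → W) =>
      β * Fintype.card V < #(dangerous u Sm (R x.1) x.2.1)) ≤ β := by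
    refine prob_prod_le hβ.le fun cS => ?_
    refine prob_prod_le' (p := fun y : (V → Fin k → W) × (V → Fin k → W) =>
      β * Fintype.card V < #(dangerous u Sm (R cS) y.1)) hβ.le fun _ => ?_
    exact prob_dangerous_le hp (hR cS) u Sm
  have hC : prob (fun x : (V → W) × (V → Fin k → W) × (V → Fin k → W) =>
      ∃ Q : Finset V, Q.Nonempty ∧ #Q ≤ ⌊β * Fintype.card V⌋₊ ∧ ∃ Y ⊆ (univ : Finset W),
        #Y = #Q ∧ ∀ v ∈ Q, ∀ i, x.2.2 v i ∈ (R x.1 ∪ Sm.image x.1) ∪ Y) ≤ 2 * β := by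
    refine prob_prod_le (by positivity) fun cS => ?_
    refine prob_prod_le (by positivity) fun c2 => ?_
    have h : (#(Sm.image cS) : ℝ) ≤ β * Fintype.card V / 2 :=
      le_trans (by exact_mod_cast Finset.card_image_le) (card_small_le hp hSm)
    have h' := prob_reserved_trapped_le (k := k) hp (hR cS) h
    exact h'
  have hD : prob (fun x : (V → W) × (V → Fin k → W) × (V → Fin k → W) =>
      ∃ Q : Finset V, Q.Nonempty ∧ #Q ≤ ⌊β ^ 3 / 9 * Fintype.card V⌋₊ ∧
        ∃ Y ⊆ R x.1, #Y = #Q ∧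
        ∀ v ∈ Q, 3 ≤ #{i | x.2.1 v i ∈ R x.1} ∧
          ∀ i, x.2.1 v i ∈ R x.1 → x.2.1 v i ∈ Y) ≤ 2 * β := by
    refine prob_prod_le (by positivity) fun cS => ?_
    refine prob_prod_le' (p := fun y : (V → Fin k → W) × (V → Fin k → W) =>
      ∃ Q : Finset V, Q.Nonempty ∧ #Q ≤ ⌊β ^ 3 / 9 * Fintype.card V⌋₊ ∧
        ∃ Y ⊆ R cS, #Y = #Q ∧ ∀ v ∈ Q, 3 ≤ #{i | y.1 v i ∈ R cS} ∧
          ∀ i, y.1 v i ∈ R cS → y.1 v i ∈ Y) (by positivity) fun _ => ?_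
    have h' := prob_reserved_hall_small_le (k := k) hp (hR cS)
    exact h'
  have hE : prob (fun x : (V → W) × (V → Fin k → W) × (V → Fin k → W) =>
      ∃ Q : Finset V, ⌊β ^ 3 / 9 * Fintype.card V⌋₊ ≤ #Q ∧ ∃ Y : Finset W,
        Fintype.card W - Fintype.card V ≤ #Y ∧ ∀ v ∈ Q, ∀ i, x.2.1 v i ∉ Y) ≤ β := by
    refine prob_prod_le hβ.le fun cS => ?_
    refine prob_prod_le' (p := fun y : (V → Fin k → W) × (V → Fin k → W) =>
      ∃ Q : Finset V, ⌊β ^ 3 / 9 * Fintype.card V⌋₊ ≤ #Q ∧ ∃ Y : Finset W,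
        Fintype.card W - Fintype.card V ≤ #Y ∧ ∀ v ∈ Q, ∀ i, y.1 v i ∉ Y) hβ.le fun _ => ?_
    exact prob_hall_large_le _ _ hp.large
  have hAB := (prob_or_le _ _).trans (add_le_add hA hB)
  have hCD := (prob_or_le _ _).trans (add_le_add hC hD)
  have hAD := (prob_or_le _ _).trans (add_le_add hAB hCD)
  have hAE := (prob_or_le _ _).trans (add_le_add hAD hE)
  refine (prob_mono fun x hx => ?_).trans (hAE.trans (by linarith))
  by_contra h
  simp only [not_or] at h
  obtain ⟨⟨⟨h1, h2⟩, h3, h4⟩, h5⟩ := h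
  subst hR'
  exact hx ⟨not_not.1 h1, h2, h3, h4, h5⟩

/-- The colours of all slots, given the colours of the small slots and of the second and third
block, and the colours of the first block. -/
def slotColour (x : (V → W) × (V → Fin k → W) × (V → Fin k → W)) (c : V → Fin k → W) (v : V) :
    Slot k → W :=
  Sum.elim (fun _ => x.1 v) (Sum.elim (c v) (Sum.elim (x.2.1 v) (x.2.2 v)))

/-- A choice `sl` of one slot at each vertex with distinct colours, such that the slots at the
vertices in `S` form a tree on `S` with root `u`. -/
structure TreeSelection (t : V → I → V) (u : V) (Sm : Finset V) (b : ℕ) (c : V → Slot k → W)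
    (τ : V → Fin k → I) (S : Finset V) (sl : V → Slot k) : Prop where
  card : #Sᶜ ≤ b
  root : u ∈ S
  small : ∀ v ∈ Sm, sl v = Sum.inl ()
  inj : Set.InjOn (fun v => c v (sl v)) {u}ᶜ
  notMem : ∀ v ∉ S, ∀ i, sl v ≠ Sum.inr (Sum.inl i)
  tree : ∃ j : V → Fin k,
    (∀ v ∈ S.erase u, sl v = Sum.inr (Sum.inl (j v)) ∧ t v (τ v (j v)) ∈ S) ∧
    ∀ Q ⊆ S.erase u, Q.Nonempty → ∃ v ∈ Q, t v (τ v (j v)) ∉ Q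

lemma exists_treeSelection (hp : Admissible β (Fintype.card V) (Fintype.card W) k)
    (t : V → I → V) (a : V → Fin k → I) {u : V} {Sm : Finset V} (hu : u ∉ Sm)
    {x : (V → W) × (V → Fin k → W) × (V → Fin k → W)} {W₀ : Finset W}
    (hW₀ : W₀ ⊆ (Sm.image x.1)ᶜ) (hcard : #W₀ = ⌈β * Fintype.card V⌉₊)
    (hN : Nice β u Sm x W₀) (d : V → Fin k)
    (hd : ∀ v ∈ dangerous u Sm W₀ x.2.1, x.2.2 v (d v) ∉ W₀ ∪ Sm.image x.1)
    (hdinj : Set.InjOn (fun v => x.2.2 v (d v)) (dangerous u Sm W₀ x.2.1))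
    (ω : V → Equiv.Perm I × (Fin k → W))
    (hT : ¬ ∃ S : Finset V, u ∈ S ∧
      (#S : ℝ) ≤ Fintype.card V - 8 * β * Fintype.card V ∧
      ∃ j, Stuck t a u (dangerous u Sm W₀ x.2.1 ∪ Sm)
        (W₀ ∪ Sm.image x.1 ∪ (dangerous u Sm W₀ x.2.1).image fun v => x.2.2 v (d v)) ω S j) :
    ∃ S sl, TreeSelection t u Sm ⌊8 * β * Fintype.card V⌋₊ (slotColour x fun v => (ω v).2)
      (fun v j => (ω v).1 (a v j)) S sl := by
  have hD : ∀ v ∈ dangerous u Sm W₀ x.2.1, v ≠ u ∧ v ∉ Sm := fun v hv => by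
    simpa [dangerous] using (Finset.mem_filter.1 hv).1
  have hD' : ∀ v, v ∉ dangerous u Sm W₀ x.2.1 → v ≠ u → v ∉ Sm →
      3 ≤ #{i | x.2.1 v i ∈ W₀} := fun v hv h1 h2 => by
    by_contra! h
    exact hv (Finset.mem_filter.2 ⟨by simp [h1, h2], by omega⟩)
  set D := dangerous u Sm W₀ x.2.1
  set CS := Sm.image x.1 with hCS
  set CD := D.image fun v => x.2.2 v (d v) with hCD
  have huB : u ∉ D ∪ Sm := by
    rw [Finset.mem_union, not_or]
    exact ⟨fun h => (hD u h).1 rfl, hu⟩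
  obtain ⟨S, j, huS, hSB, hjF, hjinj, hacyc, hstuck⟩ :=
    exists_stuck hp.k_pos t a u (D ∪ Sm) huB (W₀ ∪ CS ∪ CD) ω
  rw [Finset.disjoint_union_right] at hSB
  have hDSm : Disjoint D Sm := Finset.disjoint_left.2 fun v h h' => (hD v h).2 h'
  set CT := (S.erase u).image fun v => (ω v).2 (j v) with hCT
  have hSbig : Fintype.card V - 8 * β * Fintype.card V < (#S : ℝ) := by
    by_contra! h
    exact hT ⟨S, huS, h, j, hstuck⟩
  have hA : W₀ ⊆ (CS ∪ CD ∪ CT)ᶜ := by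
    intro y hy
    simp only [Finset.mem_compl, Finset.mem_union, not_or]
    refine ⟨⟨Finset.mem_compl.1 (hW₀ hy), fun h => ?_⟩, fun h => ?_⟩
    · obtain ⟨v, hv, rfl⟩ := Finset.mem_image.1 h
      exact hd v hv (Finset.mem_union_left _ hy)
    · obtain ⟨v, hv, rfl⟩ := Finset.mem_image.1 h
      exact hjF v hv (by simp [hy])
  have hRA : #(S ∪ D ∪ Sm)ᶜ + (Fintype.card W - Fintype.card V) ≤ #(CS ∪ CD ∪ CT)ᶜ := by
    rw [Finset.card_compl, Finset.card_compl, Finset.card_union_of_disjoint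
      (Finset.disjoint_union_left.2 ⟨hSB.2, hDSm⟩), Finset.card_union_of_disjoint hSB.1]
    have h1 : #(CS ∪ CD ∪ CT) ≤ #Sm + #D + #S :=
      (Finset.card_union_le _ _).trans (Nat.add_le_add ((Finset.card_union_le _ _).trans
        (Nat.add_le_add Finset.card_image_le Finset.card_image_le))
        (Finset.card_image_le.trans (Finset.card_le_card (Finset.erase_subset _ _))))
    have h2 : #S + #D + #Sm ≤ Fintype.card V := by
      rw [← Finset.card_union_of_disjoint hSB.1, ← Finset.card_union_of_disjoint
        (Finset.disjoint_union_left.2 ⟨hSB.2, hDSm⟩)]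
      exact Finset.card_le_univ _
    have := hp.le_w
    omega
  obtain ⟨e, heA, heinj⟩ := exists_matching_of_hall hp.k_pos W₀ (CS ∪ CD ∪ CT)ᶜ hA
    ⌊β ^ 3 / 9 * Fintype.card V⌋₊ (Fintype.card W - Fintype.card V)
    (floor_le_card_reserved hp hcard) x.2.1 (S ∪ D ∪ Sm)ᶜ
    (fun v hv => by
      simp only [Finset.mem_compl, Finset.mem_union, not_or] at hv
      exact hD' v hv.1.2 (fun h => hv.1.1 (h ▸ huS)) hv.2) hRA hN.small hN.large
  refine ⟨S, fun v => if v ∈ Sm then Sum.inl () else if v ∈ D then Sum.inr (Sum.inr (Sum.inr (d v)))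
    else if v ∈ S then Sum.inr (Sum.inl (j v)) else Sum.inr (Sum.inr (Sum.inl (e v))), ?_, huS,
    fun v hv => if_pos hv, ?_, ?_, j, fun v hv => ⟨?_, ?_⟩, hacyc⟩
  · refine Nat.le_floor ?_
    rw [Finset.card_compl, Nat.cast_sub (Finset.card_le_univ _)]
    linarith
  · have key : ∀ v ∈ ({u}ᶜ : Set V), ∃ y, slotColour x (fun v => (ω v).2) v
        (if v ∈ Sm then Sum.inl () else if v ∈ D then Sum.inr (Sum.inr (Sum.inr (d v)))
        else if v ∈ S then Sum.inr (Sum.inl (j v)) else Sum.inr (Sum.inr (Sum.inl (e v)))) = y ∧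
        ((v ∈ Sm ∧ x.1 v = y ∧ y ∈ CS) ∨ (v ∈ D ∧ x.2.2 v (d v) = y ∧ y ∈ CD ∧ y ∉ CS) ∨
        (v ∈ S.erase u ∧ (ω v).2 (j v) = y ∧ y ∈ CT ∧ y ∉ CS ∧ y ∉ CD) ∨
        (v ∈ (S ∪ D ∪ Sm)ᶜ ∧ x.2.1 v (e v) = y ∧ y ∉ CS ∧ y ∉ CD ∧ y ∉ CT)) := by
      intro v hv
      refine ⟨_, rfl, ?_⟩
      by_cases h1 : v ∈ Sm
      · simp only [if_pos h1]
        exact Or.inl ⟨h1, rfl, Finset.mem_image_of_mem _ h1⟩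
      by_cases h2 : v ∈ D
      · simp only [if_neg h1, if_pos h2]
        exact Or.inr (Or.inl ⟨h2, rfl, Finset.mem_image_of_mem (fun v => x.2.2 v (d v)) h2,
          fun h => hd v h2 (Finset.mem_union_right _ h)⟩)
      by_cases h3 : v ∈ S
      · simp only [if_neg h1, if_neg h2, if_pos h3]
        have h4 : v ∈ S.erase u := Finset.mem_erase.2 ⟨hv, h3⟩
        have h5 := hjF v h4
        simp only [Finset.mem_union, not_or] at h5
        exact Or.inr (Or.inr (Or.inl ⟨h4, rfl,
          Finset.mem_image_of_mem (fun v => (ω v).2 (j v)) h4, h5.1.2, h5.2⟩))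
      · simp only [if_neg h1, if_neg h2, if_neg h3]
        have h4 : v ∈ (S ∪ D ∪ Sm)ᶜ := by simp [h1, h2, h3]
        have h5 := heA v h4
        simp only [Finset.mem_compl, Finset.mem_union, not_or] at h5
        exact Or.inr (Or.inr (Or.inr ⟨h4, rfl, h5.1.1, h5.1.2, h5.2⟩))
    intro v hv v' hv' hvv'
    obtain ⟨y, hy, h⟩ := key v hv
    obtain ⟨y', hy', h'⟩ := key v' hv'
    obtain rfl : y = y' := by rw [← hy, ← hy']; exact hvv'
    clear key hvv' hy hy'
    rcases h with h | h | h | h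
    · rcases h' with h' | h' | h' | h'
      · exact hN.inj h.1 h'.1 (h.2.1.trans h'.2.1.symm)
      · exact (h'.2.2.2 h.2.2).elim
      · exact (h'.2.2.2.1 h.2.2).elim
      · exact (h'.2.2.1 h.2.2).elim
    · rcases h' with h' | h' | h' | h'
      · exact (h.2.2.2 h'.2.2).elim
      · exact hdinj h.1 h'.1 (h.2.1.trans h'.2.1.symm)
      · exact (h'.2.2.2.2 h.2.2.1).elim
      · exact (h'.2.2.2.1 h.2.2.1).elim
    · rcases h' with h' | h' | h' | h'
      · exact (h.2.2.2.1 h'.2.2).elim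
      · exact (h.2.2.2.2 h'.2.2.1).elim
      · exact hjinj h.1 h'.1 (h.2.1.trans h'.2.1.symm)
      · exact (h'.2.2.2.2 h.2.2.1).elim
    · rcases h' with h' | h' | h' | h'
      · exact (h.2.2.1 h'.2.2).elim
      · exact (h.2.2.2.1 h'.2.2.1).elim
      · exact (h.2.2.2.2 h'.2.2.1).elim
      · exact heinj h.1 h'.1 (h.2.1.trans h'.2.1.symm)
  · intro v hv i
    simp only [if_neg hv]
    split_ifs <;> simp
  · have h := Finset.mem_of_mem_erase hv
    rw [if_neg (Finset.disjoint_left.1 hSB.2 h), if_neg (Finset.disjoint_left.1 hSB.1 h), if_pos h]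
  · exact hstuck.1 v hv

lemma prob_no_treeSelection_le (hp : Admissible β (Fintype.card V) (Fintype.card W) k)
    (hI : Fintype.card I + 1 = Fintype.card V) {t : V → I → V} (ht : ∀ v, Injective (t v))
    (ht' : ∀ v w, w ≠ v → ∃ y, t v y = w) {a : V → Fin k → I} (ha : ∀ v, Injective (a v))
    {u : V} {Sm : Finset V} (hSm : (#Sm : ℝ) ^ 2 ≤ β * Fintype.card V) (hu : u ∉ Sm) :
    prob (fun y : ((V → W) × (V → Fin k → W) × (V → Fin k → W)) ×
        (V → Equiv.Perm I × (Fin k → W)) =>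
      ¬ ∃ S sl, TreeSelection t u Sm ⌊8 * β * Fintype.card V⌋₊
        (slotColour y.1 fun v => (y.2 v).2) (fun v j => (y.2 v).1 (a v j)) S sl) ≤ 9 * β := by
  have hβ := hp.pos
  have hβ1 := hp.le
  have h4 := hp.four_le
  obtain ⟨hn0, hw0⟩ := card_pos_of_admissible hp
  have hspec := reserved_image_spec hp hSm
  have hnice := prob_not_nice_le hp u Sm hSm
  have hsmall := card_small_le hp hSm
  generalize hR : (fun cS : V → W => reserved ⌈β * Fintype.card V⌉₊ (Sm.image cS)) = R
  replace hR := fun cS => congrFun hR cS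
  simp only [hR] at hspec hnice
  have h1 : prob (fun y : ((V → W) × (V → Fin k → W) × (V → Fin k → W)) ×
      (V → Equiv.Perm I × (Fin k → W)) => ¬ Nice β u Sm y.1 (R y.1.1)) ≤ 7 * β :=
    prob_prod_le' (p := fun y : ((V → W) × (V → Fin k → W) × (V → Fin k → W)) ×
      (V → Equiv.Perm I × (Fin k → W)) => ¬ Nice β u Sm y.1 (R y.1.1)) (by positivity)
      fun _ => hnice
  have h2 : prob (fun y : ((V → W) × (V → Fin k → W) × (V → Fin k → W)) ×
      (V → Equiv.Perm I × (Fin k → W)) => Nice β u Sm y.1 (R y.1.1) ∧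
      ¬ ∃ S sl, TreeSelection t u Sm ⌊8 * β * Fintype.card V⌋₊
        (slotColour y.1 fun v => (y.2 v).2) (fun v j => (y.2 v).1 (a v j)) S sl) ≤ 2 * β := by
    refine prob_prod_le (by positivity) fun x => ?_
    by_cases hN : Nice β u Sm x (R x.1)
    · have hDle : #(dangerous u Sm (R x.1) x.2.1) ≤ ⌊β * Fintype.card V⌋₊ :=
        Nat.le_floor (not_lt.1 hN.few)
      obtain ⟨d, hd, hdinj⟩ := exists_matching_of_not_trapped hp.k_pos _ _ hp.le_w x.2.2
        hN.trapped _ hDle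
      have hDle' : (#(dangerous u Sm (R x.1) x.2.1) : ℝ) ≤ β * Fintype.card V := not_lt.1 hN.few
      have hT := prob_exists_stuck_le ht ht' ha hI (by
          have := hp.k_le
          have hk := hp.k_pos
          have : 2 * (k + 1) ≤ Fintype.card V := by exact_mod_cast this
          omega) hp.le_w hβ.le (by linarith) hp.k_pos hp.stuck
        (by linarith) u (dangerous u Sm (R x.1) x.2.1 ∪ Sm)
        (R x.1 ∪ Sm.image x.1 ∪ (dangerous u Sm (R x.1) x.2.1).image fun v => x.2.2 v (d v)) (by
          have h : (#(dangerous u Sm (R x.1) x.2.1 ∪ Sm) : ℝ) ≤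
              #(dangerous u Sm (R x.1) x.2.1) + #Sm := by exact_mod_cast Finset.card_union_le _ _
          nlinarith) (by
          have h : (#(R x.1 ∪ Sm.image x.1 ∪
              (dangerous u Sm (R x.1) x.2.1).image fun v => x.2.2 v (d v)) : ℝ) ≤
              ⌈β * Fintype.card V⌉₊ + #Sm + #(dangerous u Sm (R x.1) x.2.1) := by
            rw [← (hspec x.1).2]
            exact_mod_cast (Finset.card_union_le _ _).trans (Nat.add_le_add
              ((Finset.card_union_le _ _).trans (Nat.add_le_add_left Finset.card_image_le _))
              Finset.card_image_le)
          have hc1 := Nat.ceil_lt_add_one (show 0 ≤ β * Fintype.card V by positivity)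
          linarith)
      refine (prob_mono fun ω hω => ?_).trans hT
      by_contra h
      exact hω.2 (exists_treeSelection hp t a hu (hspec x.1).1 (hspec x.1).2 hN d hd hdinj ω h)
    · refine (prob_mono (q := fun _ => False) fun ω hω => hN hω.1).trans ?_
      simpa [prob] using hβ.le
  refine (prob_mono fun y hy => ?_).trans ((prob_or_le _ _).trans (add_le_add h1 h2)) |>.trans
    (by linarith)
  by_cases hN : Nice β u Sm y.1 (R y.1.1)
  · exact Or.inr ⟨hN, hy⟩
  · exact Or.inl hN

/-- Separating the permutations and the colours of the first block from the other colours. -/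
def slotColourEquiv :
    ((V → W) × (V → Fin k → W) × (V → Fin k → W)) × (V → Equiv.Perm I × (Fin k → W)) ≃
      (V → Equiv.Perm I) × (V → Slot k → W) where
  toFun y := (fun v => (y.2 v).1, slotColour y.1 fun v => (y.2 v).2)
  invFun x := ((fun v => x.2 v (Sum.inl ()), fun v i => x.2 v (Sum.inr (Sum.inr (Sum.inl i))),
    fun v i => x.2 v (Sum.inr (Sum.inr (Sum.inr i)))),
    fun v => (x.1 v, fun i => x.2 v (Sum.inr (Sum.inl i))))
  left_inv y := rfl
  right_inv x := by
    refine Prod.ext rfl ?_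
    funext v s
    rcases s with s | s | s | s <;> rfl

/-- `sl` selects a slot at every vertex, the first one at the vertices of `Sm`, such that the
slots at the vertices other than `u` have distinct colours and form a spanning tree. -/
def Selects (t : V → I → V) (α : V → Slot k → I) (u : V) (Sm : Finset V)
    (x : (V → Equiv.Perm I) × (V → Slot k → W)) (sl : V → Slot k) : Prop :=
  (∀ v ∈ Sm, sl v = Sum.inl ()) ∧ Set.InjOn (fun v => x.2 v (sl v)) {u}ᶜ ∧
    ∀ Q : Finset V, Q.Nonempty → u ∉ Q → ∃ v ∈ Q, t v (x.1 v (α v (sl v))) ∉ Q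

lemma TreeSelection.selects {t : V → I → V} {α : V → Slot k → I} {u : V} {Sm : Finset V} {b : ℕ}
    {x : (V → Equiv.Perm I) × (V → Slot k → W)} {S : Finset V} {sl : V → Slot k}
    (h : TreeSelection t u Sm b x.2 (fun v j => x.1 v (α v (Sum.inr (Sum.inl j)))) S sl)
    (hS : ¬ ∃ Q ⊆ Sᶜ, Q.Nonempty ∧ ∀ v ∈ Q, t v (x.1 v (α v (sl v))) ∈ Q) :
    Selects t α u Sm x sl := by
  refine ⟨h.small, h.inj, fun Q hQ huQ => ?_⟩
  by_contra! hclosed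
  obtain ⟨j, hj, hacyc⟩ := h.tree
  by_cases hQS : (Q ∩ S).Nonempty
  · obtain ⟨v, hv, hv'⟩ := hacyc (Q ∩ S) (fun v hv => Finset.mem_erase.2
      ⟨fun h => huQ (h ▸ (Finset.mem_inter.1 hv).1), (Finset.mem_inter.1 hv).2⟩) hQS
    rw [Finset.mem_inter] at hv
    obtain ⟨h1, h2⟩ := hj v (Finset.mem_erase.2 ⟨fun h => huQ (h ▸ hv.1), hv.2⟩)
    have h3 := hclosed v hv.1
    rw [h1] at h3
    exact hv' (Finset.mem_inter.2 ⟨h3, h2⟩)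
  · rw [Finset.not_nonempty_iff_eq_empty, ← Finset.disjoint_iff_inter_eq_empty] at hQS
    exact hS ⟨Q, fun v hv => Finset.mem_compl.2 (Finset.disjoint_left.1 hQS hv), hQ, hclosed⟩

lemma prob_treeSelection_closed_le (hp : Admissible β (Fintype.card V) (Fintype.card W) k)
    (hI : Fintype.card I + 1 = Fintype.card V) {t : V → I → V} (ht : ∀ v, Injective (t v))
    {α : V → Slot k → I} (hα : ∀ v, Injective (α v)) (u : V) (Sm : Finset V)
    (c : V → Slot k → W) :
    prob (fun π : V → Equiv.Perm I =>
      (∃ S sl, TreeSelection t u Sm ⌊8 * β * Fintype.card V⌋₊ c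
        (fun v j => π v (α v (Sum.inr (Sum.inl j)))) S sl) ∧
      ¬ ∃ sl, Selects t α u Sm (π, c) sl) ≤ 96 * β := by
  have hβ := hp.pos
  have hβ1 := hp.le
  obtain ⟨hn0, -⟩ := card_pos_of_admissible hp
  have hk := hp.k_le
  have hIr : (Fintype.card I : ℝ) + 1 = Fintype.card V := by exact_mod_cast hI
  have ha : ∀ v, Injective fun j => α v (Sum.inr (Sum.inl j)) := fun v =>
    (hα v).comp (Sum.inr_injective.comp Sum.inl_injective)
  let good : (V → Fin k → I) → Prop := fun τ =>
    ∃ S sl, TreeSelection t u Sm ⌊8 * β * Fintype.card V⌋₊ c τ S sl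
  have hgood : ∀ τ, ∃ (S : Finset V) (sl : V → Slot k), good τ →
      TreeSelection t u Sm ⌊8 * β * Fintype.card V⌋₊ c τ S sl := fun τ => by
    by_cases h : good τ
    · obtain ⟨S, sl, h'⟩ := h
      exact ⟨S, sl, fun _ => h'⟩
    · exact ⟨∅, fun _ => Sum.inl (), fun h' => (h h').elim⟩
  choose S sl hSsl using hgood
  have he := Real.exp_one_lt_d9
  have hfl := Nat.floor_le (show 0 ≤ 8 * β * Fintype.card V by positivity)
  have h := prob_exists_closed_le ht ha (by
      have : (k : ℝ) < Fintype.card I := by linarith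
      exact_mod_cast this) ⌊8 * β * Fintype.card V⌋₊
    (fun τ => (S τ)ᶜ) (fun τ v => α v (sl τ v)) good (fun τ hτ => (hSsl τ hτ).card)
    (fun τ hτ v hv hmem => by
      obtain ⟨i, -, hi⟩ := Finset.mem_image.1 hmem
      exact (hSsl τ hτ).notMem v (Finset.mem_compl.1 hv) i (hα v hi).symm)
    (η := 48 * β) (by
      calc Real.exp 1 * ⌊8 * β * Fintype.card V⌋₊ ≤ 3 * (8 * β * Fintype.card V) := by
            gcongr; linarith
        _ = 48 * β * (Fintype.card V / 2) := by ring
        _ ≤ _ := by gcongr; linarith) (by positivity) (by linarith)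
  refine (prob_mono fun π hπ => ⟨hπ.1, ?_⟩).trans (h.trans (by linarith))
  by_contra hc
  exact hπ.2 ⟨_, (hSsl _ hπ.1).selects (x := (π, c)) hc⟩

theorem prob_no_selection_le (hp : Admissible β (Fintype.card V) (Fintype.card W) k)
    (hI : Fintype.card I + 1 = Fintype.card V) {t : V → I → V} (ht : ∀ v, Injective (t v))
    (ht' : ∀ v w, w ≠ v → ∃ y, t v y = w) {α : V → Slot k → I} (hα : ∀ v, Injective (α v))
    {u : V} {Sm : Finset V} (hSm : (#Sm : ℝ) ^ 2 ≤ β * Fintype.card V) (hu : u ∉ Sm) :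
    prob (fun x : (V → Equiv.Perm I) × (V → Slot k → W) => ¬ ∃ sl, Selects t α u Sm x sl) ≤
      105 * β := by
  have hβ := hp.pos
  have h1 := prob_no_treeSelection_le hp hI ht ht'
    (fun v => (hα v).comp (Sum.inr_injective.comp Sum.inl_injective)) hSm hu
  have h1' := prob_equiv (slotColourEquiv (V := V) (I := I) (W := W) (k := k)) (fun x => ¬ ∃ S sl,
    TreeSelection t u Sm ⌊8 * β * Fintype.card V⌋₊ x.2
      (fun v j => x.1 v (α v (Sum.inr (Sum.inl j)))) S sl)
  have h1'' := h1'.symm.le.trans h1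
  have h2 : prob (fun x : (V → Equiv.Perm I) × (V → Slot k → W) =>
      (∃ S sl, TreeSelection t u Sm ⌊8 * β * Fintype.card V⌋₊ x.2
        (fun v j => x.1 v (α v (Sum.inr (Sum.inl j)))) S sl) ∧
      ¬ ∃ sl, Selects t α u Sm x sl) ≤ 96 * β :=
    prob_prod_le' (by positivity) fun c => prob_treeSelection_closed_le hp hI ht hα u Sm c
  refine (prob_mono fun x hx => ?_).trans ((prob_or_le _ _).trans (add_le_add h1'' h2)) |>.trans
    (by linarith)
  by_cases h : ∃ S sl, TreeSelection t u Sm ⌊8 * β * Fintype.card V⌋₊ x.2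
    (fun v j => x.1 v (α v (Sum.inr (Sum.inl j)))) S sl
  · exact Or.inr ⟨h, hx⟩
  · exact Or.inl h

end Selection

section Arborescences

open Finset Function
open scoped Classical

variable {m : ℕ}

/-- The edge with head `v` whose tail is the `i`-th vertex different from `v`. -/
def edgeTo (v : Fin (m + 1)) (i : Fin m) : DEdge (m + 1) :=
  ⟨(v.succAbove i, v), Fin.succAbove_ne v i⟩

/-- The edges of the complete digraph are indexed by their head and the index of their tail. -/
noncomputable def edgeEquiv : Fin (m + 1) × Fin m ≃ DEdge (m + 1) :=
  Equiv.ofBijective (fun x => edgeTo x.1 x.2) ⟨fun x y h => by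
      obtain ⟨v, i⟩ := x
      obtain ⟨w, j⟩ := y
      simp only [edgeTo, Subtype.mk.injEq, Prod.mk.injEq] at h
      obtain ⟨h1, rfl⟩ := h
      exact Prod.ext rfl (Fin.succAbove_right_injective h1), fun e => by
      obtain ⟨⟨w, v⟩, h⟩ := e
      obtain ⟨i, hi⟩ := Fin.exists_succAbove_eq h
      exact ⟨(v, i), Subtype.ext (Prod.ext hi rfl)⟩⟩

lemma exists_edgeTo (e : DEdge (m + 1)) : ∃ i, edgeTo e.val.2 i = e := by
  obtain ⟨⟨v, i⟩, rfl⟩ := edgeEquiv.surjective e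
  exact ⟨i, rfl⟩

lemma edgeTo_injective : Injective fun x : Fin (m + 1) × Fin m => edgeTo x.1 x.2 :=
  edgeEquiv.injective

/-- The indices of the edges of `D(n, M)` with head `v`. -/
noncomputable def inEdges (ω : SampleSpace (m + 1)) (M : ℕ) (v : Fin (m + 1)) : Finset (Fin m) :=
  {i | edgePos ω (edgeTo v i) < M}

lemma inDegreeZero_iff (ω : SampleSpace (m + 1)) (M : ℕ) (v : Fin (m + 1)) :
    InDegreeZero ω M v ↔ #(inEdges ω M v) = 0 := by
  rw [Finset.card_eq_zero, inEdges, Finset.filter_eq_empty_iff]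
  constructor
  · exact fun h i _ hi => h _ hi rfl
  · rintro h e he rfl
    obtain ⟨i, hi⟩ := exists_edgeTo e
    exact h (Finset.mem_univ i) (hi ▸ he)

lemma isSpanningArborescence_of_no_closed (u : Fin (m + 1)) (y : Fin (m + 1) → Fin m)
    (h : ∀ Q : Finset (Fin (m + 1)), Q.Nonempty → u ∉ Q → ∃ v ∈ Q, v.succAbove (y v) ∉ Q) :
    IsSpanningArborescence {e | ∃ v ≠ u, e = edgeTo v (y v)} u := by
  refine ⟨?_, fun v hv => ⟨edgeTo v (y v), ⟨⟨v, hv, rfl⟩, rfl⟩, ?_⟩, fun v => ?_⟩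
  · rintro e ⟨v, hv, rfl⟩
    exact hv
  · rintro e ⟨⟨w, -, rfl⟩, rfl⟩
    rfl
  · by_contra hv
    obtain ⟨w, hw, hw'⟩ := h {w | ¬ Relation.ReflTransGen (fun x x' =>
      ∃ e ∈ {e | ∃ v ≠ u, e = edgeTo v (y v)}, (e : DEdge (m + 1)).val = (x, x')) u w}
      ⟨v, Finset.mem_filter.2 ⟨Finset.mem_univ _, hv⟩⟩ fun h =>
        (Finset.mem_filter.1 h).2 Relation.ReflTransGen.refl
    simp only [Finset.mem_filter, Finset.mem_univ, true_and, not_not] at hw hw'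
    refine hw (hw'.tail ⟨_, ⟨w, fun h => hw ?_, rfl⟩, rfl⟩)
    rw [h]

lemma REvent.aEvent {n M : ℕ} {ω : SampleSpace n} (h : REvent ω M) : AEvent ω M := by
  obtain ⟨u, A, h1, h2, -⟩ := h
  exact ⟨u, A, h1, h2⟩

lemma AEvent.zEvent {n M : ℕ} {ω : SampleSpace n} (h : AEvent ω M) : ZEvent ω M := by
  obtain ⟨u, A, h1, -, h2, -⟩ := h
  have key : ∀ v, InDegreeZero ω M v → v = u := fun v hv => by
    by_contra hvu
    obtain ⟨e, ⟨he, he'⟩, -⟩ := h2 v hvu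
    exact hv e (h1 e he) he'
  exact fun v hv w hw => (key v hv).trans (key w hw).symm

lemma zEvent_all (ω : SampleSpace (m + 1)) : ZEvent ω ((m + 1) * (m + 1 - 1)) := by
  intro v hv w _
  by_contra h
  refine hv ⟨(w, v), fun h' => h h'.symm⟩ ?_ rfl
  refine (Fin.is_lt _).trans_eq ?_
  rw [← Fintype.card_congr (edgeEquiv (m := m))]
  simp

lemma hitTime_mem {P : ℕ → Prop} {n : ℕ} (h : P (n * (n - 1))) : P (hitTime n P) := by
  have := Nat.sInf_mem (s := {m | P m} ∪ {n * (n - 1)}) ⟨_, Or.inr rfl⟩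
  rcases this with h' | h'
  · exact h'
  · rw [hitTime, Set.mem_singleton_iff.1 h']
    exact h

lemma hitTime_le_of_imp {P Q : ℕ → Prop} (n : ℕ) (h : ∀ m, P m → Q m) :
    hitTime n Q ≤ hitTime n P :=
  csInf_le_csInf (OrderBot.bddBelow _) ⟨_, Or.inr rfl⟩ (Set.union_subset_union_left _ h)

lemma hitTimes_eq_of_rEvent {n : ℕ} {ω : SampleSpace n} (h : REvent ω (hitTime n (ZEvent ω))) :
    hitTime n (REvent ω) = hitTime n (AEvent ω) ∧ hitTime n (AEvent ω) = hitTime n (ZEvent ω) := by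
  have h1 : hitTime n (REvent ω) ≤ hitTime n (ZEvent ω) := Nat.sInf_le (Or.inl h)
  have h2 := hitTime_le_of_imp n (P := AEvent ω) (Q := ZEvent ω) fun _ => AEvent.zEvent
  have h3 := hitTime_le_of_imp n (P := REvent ω) (Q := AEvent ω) fun _ => REvent.aEvent
  omega

/-- The permutation of the edges which permutes the edges with head `v` according to `g v`. -/
noncomputable def edgePerm (g : Fin (m + 1) → Equiv.Perm (Fin m)) : Equiv.Perm (DEdge (m + 1)) :=
  edgeEquiv.symm.trans ((Equiv.prodShear (Equiv.refl _) g).trans edgeEquiv)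

lemma edgePerm_edgeTo (g : Fin (m + 1) → Equiv.Perm (Fin m)) (v : Fin (m + 1)) (i : Fin m) :
    edgePerm g (edgeTo v i) = edgeTo v (g v i) := by
  have : edgeTo v i = edgeEquiv (v, i) := rfl
  rw [this, edgePerm]
  simp only [Equiv.trans_apply, Equiv.symm_apply_apply]
  rfl

/-- Permuting the edges with the same head. -/
noncomputable def permuteEdges (g : Fin (m + 1) → Equiv.Perm (Fin m)) :
    SampleSpace (m + 1) ≃ SampleSpace (m + 1) :=
  Equiv.prodCongr (Equiv.mulRight (edgePerm g)⁻¹)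
    (Equiv.arrowCongr (edgePerm g) (Equiv.refl _))

lemma edgePos_permuteEdges (g : Fin (m + 1) → Equiv.Perm (Fin m)) (ω : SampleSpace (m + 1))
    (v : Fin (m + 1)) (i : Fin m) :
    edgePos (permuteEdges g ω) (edgeTo v (g v i)) = edgePos ω (edgeTo v i) := by
  rw [← edgePerm_edgeTo]
  simp [edgePos, permuteEdges]

lemma colour_permuteEdges (g : Fin (m + 1) → Equiv.Perm (Fin m)) (ω : SampleSpace (m + 1))
    (v : Fin (m + 1)) (i : Fin m) :
    (permuteEdges g ω).2 (edgeTo v (g v i)) = ω.2 (edgeTo v i) := by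
  rw [← edgePerm_edgeTo]
  simp [permuteEdges]

lemma card_inEdges_permuteEdges (g : Fin (m + 1) → Equiv.Perm (Fin m)) (ω : SampleSpace (m + 1))
    (M : ℕ) (v : Fin (m + 1)) :
    #(inEdges (permuteEdges g ω) M v) = #(inEdges ω M v) := by
  refine (Finset.card_equiv (g v) fun i => ?_).symm
  simp [inEdges, edgePos_permuteEdges]

lemma zEvent_permuteEdges (g : Fin (m + 1) → Equiv.Perm (Fin m)) (ω : SampleSpace (m + 1)) :
    ZEvent (permuteEdges g ω) = ZEvent ω := by
  funext M
  simp only [ZEvent, inDegreeZero_iff, card_inEdges_permuteEdges]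

/-- Choosing new colours and permuting the edges with the same head. -/
noncomputable def reshuffle :
    SampleSpace (m + 1) × (Fin (m + 1) → Equiv.Perm (Fin m)) × (DEdge (m + 1) → Colour (m + 1)) ≃
      SampleSpace (m + 1) × (Fin (m + 1) → Equiv.Perm (Fin m)) ×
        (DEdge (m + 1) → Colour (m + 1)) where
  toFun x := (permuteEdges x.2.1 (x.1.1, x.2.2), x.2.1, x.1.2)
  invFun x := ((((permuteEdges x.2.1).symm x.1).1, x.2.2), x.2.1, ((permuteEdges x.2.1).symm x.1).2)
  left_inv x := by simp
  right_inv x := by simp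

lemma exists_embedding_slots {k : ℕ} (hk : 3 * k + 1 ≤ m) (P : Finset (Fin m)) (hP : P.Nonempty) :
    ∃ α : Slot k → Fin m, Injective α ∧ α (Sum.inl ()) ∈ P ∧ (3 * k < #P → ∀ s, α s ∈ P) := by
  have hcard : Fintype.card (Slot k) = 3 * k + 1 := by simp; ring
  by_cases h : 3 * k < #P
  · obtain ⟨f⟩ := Embedding.nonempty_of_card_le (α := Slot k) (β := P) (by
      rw [hcard, Fintype.card_coe]; omega)
    exact ⟨fun s => f s, Subtype.val_injective.comp f.injective, (f _).2, fun _ s => (f s).2⟩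
  · obtain ⟨f⟩ := Embedding.nonempty_of_card_le (α := Slot k) (β := Fin m) (by
      rw [hcard, Fintype.card_fin]; omega)
    obtain ⟨y, hy⟩ := hP
    exact ⟨fun s => Equiv.swap (f (Sum.inl ())) y (f s),
      (Equiv.injective _).comp f.injective, by simpa using hy, fun h' => (h h').elim⟩

/-- When at most one vertex of in-degree zero remains, only few vertices have in-degree at most
`3 * k`. -/
def FewSmall (β : ℝ) (k : ℕ) (ω : SampleSpace (m + 1)) : Prop :=
  (#{v | #(inEdges ω (hitTime (m + 1) (ZEvent ω)) v) ≤ 3 * k} : ℝ) ^ 2 ≤ β * (m + 1 : ℕ)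

lemma prob_selection_edges_le {β : ℝ} {k : ℕ} [Nonempty (Colour (m + 1))]
    (hp : Admissible β (m + 1) (numColours (m + 1)) k) {α : Fin (m + 1) → Slot k → Fin m}
    (hα : ∀ v, Injective (α v)) {u : Fin (m + 1)} {Sm : Finset (Fin (m + 1))}
    (hSm : (#Sm : ℝ) ^ 2 ≤ β * (m + 1 : ℕ)) (hu : u ∉ Sm) :
    prob (fun x : (Fin (m + 1) → Equiv.Perm (Fin m)) × (DEdge (m + 1) → Colour (m + 1)) =>
      ¬ ∃ sl, Selects (fun v => v.succAbove) α u Sm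
        (x.1, fun v s => x.2 (edgeTo v (α v s))) sl) ≤ 105 * β := by
  have h := prob_no_selection_le (V := Fin (m + 1)) (I := Fin m) (W := Colour (m + 1)) (k := k)
    (β := β) (t := fun v => v.succAbove) (by simpa using hp) (by simp)
    (fun v => Fin.succAbove_right_injective) (fun v w hw => Fin.exists_succAbove_eq hw)
    hα (u := u) (Sm := Sm) (by simpa using hSm) hu
  refine le_trans (le_of_eq ?_) h
  rw [prob_prod, prob_prod]
  congr 1
  funext g
  have hinj : Injective fun x : Fin (m + 1) × Slot k => edgeTo x.1 (α x.1 x.2) := fun x y hxy => by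
    have := edgeTo_injective (a₁ := (x.1, α x.1 x.2)) (a₂ := (y.1, α y.1 y.2)) hxy
    obtain ⟨v, s⟩ := x
    obtain ⟨w, s'⟩ := y
    simp only [Prod.mk.injEq] at this
    obtain ⟨rfl, h2⟩ := this
    rw [hα _ h2]
  have h1 := prob_comp_injective (W := Colour (m + 1)) _ hinj fun c =>
    ¬ ∃ sl, Selects (fun v => v.succAbove) α u Sm (g, fun v s => c (v, s)) sl
  have h2 := prob_equiv (Equiv.curry (Fin (m + 1)) (Slot k) (Colour (m + 1))) fun c =>
    ¬ ∃ sl, Selects (fun v => v.succAbove) α u Sm (g, c) sl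
  exact h1.trans h2

lemma prob_not_rEvent_le {β : ℝ} {k : ℕ} (hp : Admissible β (m + 1) (numColours (m + 1)) k)
    (hk : 3 * k + 1 ≤ m) :
    prob (fun ω : SampleSpace (m + 1) => FewSmall β k ω ∧
      ¬ REvent ω (hitTime (m + 1) (ZEvent ω))) ≤ 105 * β := by
  have hβ := hp.pos
  have : NeZero (numColours (m + 1)) := ⟨by have := hp.le_w; omega⟩
  have : Nonempty (Colour (m + 1)) := inferInstance
  refine prob_le_of_resample reshuffle (by positivity) fun ω₀ => ?_
  obtain ⟨σ, χ₀⟩ := ω₀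
  generalize hM : hitTime (m + 1) (ZEvent (σ, χ₀)) = M
  have hZ : ZEvent (σ, χ₀) M := hM ▸ hitTime_mem (zEvent_all _)
  obtain ⟨u, hu⟩ : ∃ u, ∀ v ≠ u, (inEdges (σ, χ₀) M v).Nonempty := by
    by_cases h : ∃ u, InDegreeZero (σ, χ₀) M u
    · obtain ⟨u, hu⟩ := h
      refine ⟨u, fun v hv => ?_⟩
      by_contra h'
      refine hv (hZ ?_ hu)
      rw [Set.mem_ofPred_eq, inDegreeZero_iff, Finset.card_eq_zero]
      exact Finset.not_nonempty_iff_eq_empty.1 h'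
    · refine ⟨0, fun v _ => ?_⟩
      by_contra h'
      refine h ⟨v, ?_⟩
      rw [inDegreeZero_iff, Finset.card_eq_zero]
      exact Finset.not_nonempty_iff_eq_empty.1 h'
  by_cases hfew : FewSmall β k (σ, χ₀)
  swap
  · refine (prob_mono (q := fun _ => False) fun x hx => hfew ?_).trans
      (by simpa [prob] using hβ.le)
    have := hx.1
    simp only [FewSmall, reshuffle, Equiv.coe_fn_mk, zEvent_permuteEdges,
      card_inEdges_permuteEdges] at this
    exact this
  have hα : ∀ v, ∃ α : Slot k → Fin m, Injective α ∧ (v ≠ u → α (Sum.inl ()) ∈ inEdges (σ, χ₀) M v) ∧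
      (v ≠ u → 3 * k < #(inEdges (σ, χ₀) M v) → ∀ s, α s ∈ inEdges (σ, χ₀) M v) := fun v => by
    by_cases hv : v = u
    · have : (univ : Finset (Fin m)).Nonempty := ⟨⟨0, by omega⟩, Finset.mem_univ _⟩
      obtain ⟨α, h1, -⟩ := exists_embedding_slots hk _ this
      exact ⟨α, h1, fun h => (h hv).elim, fun h => (h hv).elim⟩
    · obtain ⟨α, h1, h2, h3⟩ := exists_embedding_slots hk _ (hu v hv)
      exact ⟨α, h1, fun _ => h2, fun _ => h3⟩
  choose α hαinj hα1 hα2 using hα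
  let Sm : Finset (Fin (m + 1)) := {v | v ≠ u ∧ #(inEdges (σ, χ₀) M v) ≤ 3 * k}
  have hSm : (#Sm : ℝ) ^ 2 ≤ β * (m + 1 : ℕ) := by
    refine le_trans ?_ hfew
    rw [hM]
    gcongr
    intro v hv
    exact Finset.mem_filter.2 ⟨Finset.mem_univ _, (Finset.mem_filter.1 hv).2.2⟩
  refine (prob_mono fun x hx => ?_).trans
    (prob_selection_edges_le hp hαinj hSm (u := u) (by simp [Sm]))
  rintro ⟨sl, hsl1, hsl2, hsl3⟩
  have hmem : ∀ v ≠ u, α v (sl v) ∈ inEdges (σ, χ₀) M v := fun v hv => by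
    by_cases hv' : #(inEdges (σ, χ₀) M v) ≤ 3 * k
    · rw [hsl1 v (by simp [Sm, hv, hv'])]
      exact hα1 v hv
    · exact hα2 v hv (not_le.1 hv') _
  refine hx.2 ?_
  have hM' : hitTime (m + 1) (ZEvent (reshuffle ((σ, χ₀), x)).1) = M := by
    simp only [reshuffle, Equiv.coe_fn_mk, zEvent_permuteEdges]
    exact hM
  rw [hM']
  refine ⟨u, _, ?_, isSpanningArborescence_of_no_closed u (fun v => x.1 v (α v (sl v))) hsl3, ?_⟩
  · rintro e ⟨v, hv, rfl⟩
    have := (Finset.mem_filter.1 (hmem v hv)).2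
    rw [inProcess]
    refine lt_of_eq_of_lt ?_ this
    exact edgePos_permuteEdges x.1 (σ, x.2) v _
  · rintro e ⟨v, hv, rfl⟩ e' ⟨v', hv', rfl⟩ h
    have h1 := colour_permuteEdges x.1 (σ, x.2) v (α v (sl v))
    have h2 := colour_permuteEdges x.1 (σ, x.2) v' (α v' (sl v'))
    have h3 : v = v' := hsl2 hv hv' (h1.symm.trans (h.trans h2))
    rw [h3]

end Arborescences

section Moments

open Finset Function
open scoped Classical BigOperators

variable {Ω V : Type*} [Fintype Ω] [Fintype V]

lemma expect_ind_mul_ind (p q : Ω → Prop) :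
    𝔼 ω, ind (p ω) * ind (q ω) = prob fun ω => p ω ∧ q ω := by
  simp only [prob_eq_expect, ind_and]

lemma cast_card_filter_eq_sum_ind (q : V → Prop) : (#{v | q v} : ℝ) = ∑ v, ind (q v) := by
  rw [Finset.card_filter]
  push_cast
  exact Finset.sum_congr rfl fun v _ => by by_cases h : q v <;> simp [ind, h]

lemma prob_lt_card_filter_le (q : V → Ω → Prop) {a b : ℝ} (hb : 0 < b)
    (hq : ∀ v, prob (q v) ≤ a) :
    prob (fun ω => b < #{v | q v ω}) ≤ Fintype.card V * a / b := by
  refine (prob_le_expect_div (f := fun ω => ∑ v, ind (q v ω))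
    (fun ω => Finset.sum_nonneg fun v _ => ind_nonneg _) hb fun ω hω => ?_).trans ?_
  · rw [← cast_card_filter_eq_sum_ind]
    exact hω.le
  · rw [Finset.expect_sum_comm]
    gcongr
    rw [← nsmul_eq_mul, ← Finset.card_univ]
    refine Finset.sum_le_card_nsmul _ _ _ fun v _ => ?_
    rw [← prob_eq_expect]
    exact hq v

variable [Nonempty Ω]

/-- Chebyshev's inequality for a sum of negatively correlated indicators. -/
lemma prob_card_filter_le_one_le (q : V → Ω → Prop) {p : ℝ} (hq : ∀ v, prob (q v) = p)
    (hpair : ∀ v w, v ≠ w → prob (fun ω => q v ω ∧ q w ω) ≤ p ^ 2)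
    (hμ : 2 ≤ Fintype.card V * p) :
    prob (fun ω => #{v | q v ω} ≤ 1) ≤ 4 / (Fintype.card V * p) := by
  set μ := Fintype.card V * p with hμdef
  have h1 : 𝔼 ω, ∑ v, ind (q v ω) = μ := by
    rw [Finset.expect_sum_comm]
    simp only [← prob_eq_expect, hq]
    simp [hμdef]
  have h2 : 𝔼 ω, (∑ v, ind (q v ω)) ^ 2 ≤ μ + μ ^ 2 := by
    simp only [sq (∑ v, ind (q v _)), Finset.sum_mul_sum]
    rw [Finset.expect_sum_comm]
    simp only [Finset.expect_sum_comm, expect_ind_mul_ind]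
    have h3 : ∀ v w, prob (fun ω => q v ω ∧ q w ω) ≤ (if v = w then p else 0) + p ^ 2 := by
      intro v w
      split_ifs with h
      · subst h
        simp only [and_self, hq]
        have := sq_nonneg p
        linarith
      · rw [zero_add]
        exact hpair v w h
    refine (Finset.sum_le_sum fun v _ => Finset.sum_le_sum fun w _ => h3 v w).trans (le_of_eq ?_)
    simp only [Finset.sum_add_distrib, Finset.sum_ite_eq, Finset.mem_univ, if_true,
      Finset.sum_const, Finset.card_univ, nsmul_eq_mul]
    ring
  have h4 : 𝔼 ω, (∑ v, ind (q v ω) - μ) ^ 2 ≤ μ := by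
    have h5 : ∀ ω, (∑ v, ind (q v ω) - μ) ^ 2 =
        (∑ v, ind (q v ω)) ^ 2 - 2 * μ * ∑ v, ind (q v ω) + μ ^ 2 := fun ω => by ring
    simp only [h5, Finset.expect_add_distrib, Finset.expect_sub_distrib, ← Finset.mul_expect, h1,
      Finset.expect_const Finset.univ_nonempty]
    linarith
  refine (prob_le_expect_div (f := fun ω => (∑ v, ind (q v ω) - μ) ^ 2)
    (fun ω => sq_nonneg _) (a := (μ / 2) ^ 2) (by positivity) fun ω hω => ?_).trans ?_
  · have h6 : ∑ v, ind (q v ω) ≤ 1 := by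
      rw [← cast_card_filter_eq_sum_ind]
      exact_mod_cast hω
    nlinarith
  · rw [div_le_div_iff₀ (by positivity) (by linarith)]
    nlinarith

end Moments

section Degrees

open Finset Function
open scoped Classical BigOperators

variable {m : ℕ}

/-- The first `M` edges in a fixed enumeration. -/
noncomputable def firstEdges (m M : ℕ) : Finset (DEdge (m + 1)) :=
  {e | (Fintype.equivFin (DEdge (m + 1)) e).val < M}

lemma card_edges : Fintype.card (DEdge (m + 1)) = (m + 1) * m := by
  rw [← Fintype.card_congr (edgeEquiv (m := m))]
  simp

lemma card_firstEdges {M : ℕ} (hM : M ≤ (m + 1) * m) : #(firstEdges m M) = M := by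
  rw [firstEdges, Finset.card_equiv (t := {i : Fin (Fintype.card (DEdge (m + 1))) | i.val < M})
    (Fintype.equivFin (DEdge (m + 1))) fun e => by simp, Fin.card_filter_val_lt, card_edges,
    min_eq_right hM]

/-- The edges with head `v`. -/
noncomputable def edgesTo (v : Fin (m + 1)) : Finset (DEdge (m + 1)) :=
  univ.image (edgeTo v)

lemma edgeTo_injective_right (v : Fin (m + 1)) : Injective (edgeTo v) := fun i j h => by
  have := edgeTo_injective (a₁ := (v, i)) (a₂ := (v, j)) h
  simpa using this

lemma card_edgesTo (v : Fin (m + 1)) : #(edgesTo v) = m := by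
  rw [edgesTo, Finset.card_image_of_injective _ (edgeTo_injective_right v), Finset.card_univ,
    Fintype.card_fin]

lemma disjoint_edgesTo {v w : Fin (m + 1)} (h : v ≠ w) : Disjoint (edgesTo v) (edgesTo w) := by
  rw [Finset.disjoint_left]
  rintro e he he'
  obtain ⟨i, -, rfl⟩ := Finset.mem_image.1 he
  obtain ⟨j, -, hj⟩ := Finset.mem_image.1 he'
  have := edgeTo_injective (a₁ := (w, j)) (a₂ := (v, i)) hj
  simp only [Prod.mk.injEq] at this
  exact h this.1.symm

lemma card_inEdges (ω : SampleSpace (m + 1)) (M : ℕ) (v : Fin (m + 1)) :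
    #(inEdges ω M v) = #{e ∈ edgesTo v | ω.1 e ∈ firstEdges m M} := by
  rw [edgesTo, Finset.filter_image, Finset.card_image_of_injective _ (edgeTo_injective_right v)]
  refine congrArg _ (Finset.ext fun i => ?_)
  rw [inEdges, Finset.mem_filter, Finset.mem_filter]
  simp [firstEdges, edgePos]

lemma inEdges_mono (ω : SampleSpace (m + 1)) {M M' : ℕ} (h : M ≤ M') (v : Fin (m + 1)) :
    inEdges ω M v ⊆ inEdges ω M' v := fun i hi => by
  simp only [inEdges, Finset.mem_filter, Finset.mem_univ, true_and] at hi ⊢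
  omega

lemma ZEvent.mono {ω : SampleSpace (m + 1)} {M M' : ℕ} (h : M ≤ M') (hZ : ZEvent ω M) :
    ZEvent ω M' := by
  refine Set.Subsingleton.anti hZ fun v hv => ?_
  exact fun e he => hv e (lt_of_lt_of_le he h)

lemma prob_inDegree_le {M : ℕ} (hm : 0 < m) (hM : M ≤ (m + 1) * m) (v : Fin (m + 1)) (d : ℕ) :
    prob (fun σ : Equiv.Perm (DEdge (m + 1)) => #{e ∈ edgesTo v | σ e ∈ firstEdges m M} ≤ d) ≤
      Real.exp (2 * d) * Real.exp (-(4 / 5 * (M / (m + 1)))) := by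
  have hx : Real.exp (-2) ≤ 1 / 5 := by
    rw [Real.exp_neg, ← one_div]
    refine one_div_le_one_div_of_le (by norm_num) ?_
    have h1 : Real.exp 2 = Real.exp 1 ^ 2 := by rw [← Real.exp_nat_mul]; norm_num
    have h2 := Real.exp_one_gt_d9
    rw [h1]
    nlinarith
  have hx0 := Real.exp_pos (-2)
  have h := expect_perm_pow_le (edgesTo v) (firstEdges m M) hx0.le (by linarith)
  refine (prob_le_expect_div (f := fun σ : Equiv.Perm (DEdge (m + 1)) =>
    Real.exp (-2) ^ #{e ∈ edgesTo v | σ e ∈ firstEdges m M}) (fun _ => by positivity)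
    (a := Real.exp (-2) ^ d) (by positivity)
    fun σ hσ => pow_le_pow_of_le_one hx0.le (by linarith) hσ).trans ?_
  rw [card_firstEdges hM, card_edges, card_edgesTo] at h
  have h3 : (Real.exp (-2) ^ d)⁻¹ = Real.exp (2 * d) := by
    rw [← Real.exp_nat_mul, ← Real.exp_neg]
    congr 1
    ring
  rw [div_eq_mul_inv, h3, mul_comm]
  have hm' : (0 : ℝ) < m := by exact_mod_cast hm
  have hM' : (M : ℝ) ≤ (m + 1) * m := by exact_mod_cast hM
  have hq : (M : ℝ) / ((m + 1) * m) ≤ 1 := by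
    rw [div_le_one (by positivity)]; exact hM'
  have hq0 : (0 : ℝ) ≤ M / ((m + 1) * m) := by positivity
  gcongr
  refine h.trans ?_
  push_cast
  calc (1 - (1 - Real.exp (-2)) * (M / ((m + 1) * m)) : ℝ) ^ m
      ≤ Real.exp (-(4 / 5 * (M / ((m + 1) * m)))) ^ m := by
        refine pow_le_pow_left₀ (by nlinarith) ?_ _
        have := Real.add_one_le_exp (-(4 / 5 * (M / ((m + 1) * m) : ℝ)))
        nlinarith
    _ = _ := by
        rw [← Real.exp_nat_mul]
        congr 1
        field_simp

lemma prob_many_small_inDegree_le {M : ℕ} (hm : 0 < m) (hM : M ≤ (m + 1) * m) (d : ℕ) {b : ℝ}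
    (hb : 0 < b) :
    prob (fun σ : Equiv.Perm (DEdge (m + 1)) =>
      b < #{v | #{e ∈ edgesTo v | σ e ∈ firstEdges m M} ≤ d}) ≤
      (m + 1) * (Real.exp (2 * d) * Real.exp (-(4 / 5 * (M / (m + 1))))) / b := by
  have h := prob_lt_card_filter_le (V := Fin (m + 1)) (Ω := Equiv.Perm (DEdge (m + 1)))
    (fun v σ => #{e ∈ edgesTo v | σ e ∈ firstEdges m M} ≤ d) hb
    fun v => prob_inDegree_le hm hM v d
  rw [Fintype.card_fin] at h
  push_cast at h
  convert h

lemma prob_at_most_one_zero_le {M : ℕ} (hM : M + 2 * m ≤ (m + 1) * m) {μ : ℝ} (hμ : 2 ≤ μ)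
    (hμ' : μ ≤ (m + 1) * (1 - M / m ^ 2 : ℝ) ^ m) :
    prob (fun σ : Equiv.Perm (DEdge (m + 1)) =>
      #{v | ∀ e ∈ edgesTo v, σ e ∉ firstEdges m M} ≤ 1) ≤ 4 / μ := by
  have hM0 : M ≤ (m + 1) * m := by omega
  have hMr : (M : ℝ) + 2 * m ≤ (m + 1) * m := by exact_mod_cast hM
  have hm : 0 < m := by
    rcases Nat.eq_zero_or_pos m with rfl | h
    · norm_num at hμ'
      linarith
    · exact h
  have hm' : (0 : ℝ) < m := by exact_mod_cast hm
  let f : ℕ → ℝ := fun l => 1 - M / (((m + 1) * m : ℕ) - l)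
  have hden : ∀ l < 2 * m, (0 : ℝ) < ((m + 1) * m : ℕ) - l ∧ (M : ℝ) ≤ ((m + 1) * m : ℕ) - l := by
    intro l hl
    have hl' : (l : ℝ) < 2 * m := by exact_mod_cast hl
    have hM0' : (0 : ℝ) ≤ M := by positivity
    push_cast
    constructor <;> linarith
  have hf0 : ∀ l < 2 * m, 0 ≤ f l := fun l hl => by
    have := hden l hl
    simp only [f, sub_nonneg]
    rw [div_le_one this.1]
    exact this.2
  have hf1 : ∀ l, l + m < 2 * m → f (l + m) ≤ f l := fun l hl => by
    have h1 := (hden _ hl).1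
    have h2 := (hden l (by omega)).1
    simp only [f]
    gcongr
    omega
  have h1 : ∀ v : Fin (m + 1), prob (fun σ : Equiv.Perm (DEdge (m + 1)) =>
      ∀ e ∈ edgesTo v, σ e ∉ firstEdges m M) = ∏ l ∈ range m, f l := fun v => by
    rw [prob_perm_avoid, card_edgesTo, card_firstEdges hM0, card_edges]
  have h2 : ∀ v w : Fin (m + 1), v ≠ w → prob (fun σ : Equiv.Perm (DEdge (m + 1)) =>
      (∀ e ∈ edgesTo v, σ e ∉ firstEdges m M) ∧ ∀ e ∈ edgesTo w, σ e ∉ firstEdges m M) ≤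
      (∏ l ∈ range m, f l) ^ 2 := fun v w hvw => by
    rw [prob_congr (q := fun σ => ∀ e ∈ edgesTo v ∪ edgesTo w, σ e ∉ firstEdges m M) fun σ => by
      simp only [Finset.mem_union, or_imp, forall_and], prob_perm_avoid,
      Finset.card_union_of_disjoint (disjoint_edgesTo hvw), card_edgesTo, card_edgesTo,
      card_firstEdges hM0, card_edges, Finset.prod_range_add, sq]
    refine mul_le_mul_of_nonneg_left (Finset.prod_le_prod (fun l hl => ?_) fun l hl => ?_)
      (Finset.prod_nonneg fun l hl => hf0 l ?_)
    · exact hf0 (m + l) (by have := Finset.mem_range.1 hl; omega)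
    · have := hf1 l (by have := Finset.mem_range.1 hl; omega)
      rwa [add_comm] at this
    · have := Finset.mem_range.1 hl; omega
  have h3 : (1 - M / m ^ 2 : ℝ) ^ m ≤ ∏ l ∈ range m, f l := by
    have h4 : 0 ≤ (1 - M / m ^ 2 : ℝ) := by
      rw [sub_nonneg, div_le_one (by positivity)]
      nlinarith
    have := Finset.prod_le_prod (s := range m) (f := fun _ => (1 - M / m ^ 2 : ℝ)) (g := f)
      (fun _ _ => h4) fun l hl => by
        have hl' : (l : ℝ) < m := by exact_mod_cast Finset.mem_range.1 hl
        simp only [f]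
        gcongr
        push_cast
        nlinarith
    simpa using this
  have hμp : μ ≤ (m + 1) * ∏ l ∈ range m, f l := hμ'.trans (by gcongr)
  have h := prob_card_filter_le_one_le (V := Fin (m + 1)) (Ω := Equiv.Perm (DEdge (m + 1)))
    (fun v σ => ∀ e ∈ edgesTo v, σ e ∉ firstEdges m M) h1 h2 (by
      rw [Fintype.card_fin]
      push_cast
      linarith)
  rw [Fintype.card_fin] at h
  push_cast at h
  refine le_trans (le_of_eq ?_) (h.trans (by gcongr))
  convert rfl

lemma prob_not_fewSmall_le {β : ℝ} (hβ : 0 < β) {k M : ℕ} [Nonempty (Colour (m + 1))]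
    (hM : M + 2 * m ≤ (m + 1) * m) {μ : ℝ} (hμ : 2 ≤ μ)
    (hμ' : μ ≤ (m + 1) * (1 - M / m ^ 2 : ℝ) ^ m) :
    prob (fun ω : SampleSpace (m + 1) => ¬ FewSmall β k ω) ≤
      4 / μ + (m + 1) * (Real.exp (6 * k) * Real.exp (-(4 / 5 * (M / (m + 1))))) /
        Real.sqrt (β * (m + 1)) := by
  have hm : 0 < m := by
    rcases Nat.eq_zero_or_pos m with rfl | h
    · norm_num at hμ'
      linarith
    · exact h
  have hb : 0 < Real.sqrt (β * (m + 1)) := Real.sqrt_pos.2 (by positivity)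
  have h1 := prob_at_most_one_zero_le hM hμ hμ'
  have h2 := prob_many_small_inDegree_le hm (by omega : M ≤ (m + 1) * m) (3 * k) hb
  have h3 : (2 * ((3 * k : ℕ) : ℝ)) = 6 * k := by push_cast; ring
  rw [h3] at h2
  rw [← prob_prod_fst (Ω' := DEdge (m + 1) → Colour (m + 1))] at h1 h2
  refine (prob_mono fun ω hω => ?_).trans ((prob_or_le _ _).trans (add_le_add h1 h2))
  by_contra! hc
  obtain ⟨hc1, hc2⟩ := hc
  have hlt : M ≤ hitTime (m + 1) (ZEvent ω) := by
    by_contra! h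
    have hZ := (hitTime_mem (zEvent_all ω)).mono h.le
    rw [Finset.one_lt_card] at hc1
    obtain ⟨v, hv, w, hw, hvw⟩ := hc1
    have hzero : ∀ v, (∀ e ∈ edgesTo v, ω.1 e ∉ firstEdges m M) → InDegreeZero ω M v :=
      fun v hv => by
        rw [inDegreeZero_iff, card_inEdges, Finset.card_eq_zero, Finset.filter_eq_empty_iff]
        exact hv
    exact hvw (hZ (hzero v (Finset.mem_filter.1 hv).2) (hzero w (Finset.mem_filter.1 hw).2))
  refine hω ?_
  rw [FewSmall]
  have h4 : (#{v | #(inEdges ω (hitTime (m + 1) (ZEvent ω)) v) ≤ 3 * k} : ℝ) ≤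
      #{v | #{e ∈ edgesTo v | ω.1 e ∈ firstEdges m M} ≤ 3 * k} := by
    gcongr with v
    rw [← card_inEdges]
    exact Finset.card_le_card (inEdges_mono ω hlt v)
  calc _ ≤ Real.sqrt (β * (m + 1)) ^ 2 := by gcongr; exact h4.trans hc2
    _ = _ := by rw [Real.sq_sqrt (by positivity)]; push_cast; rfl

end Degrees

section Asymptotics

open Topology Real

lemma tendsto_log_natCast : Tendsto (fun n : ℕ => log n) atTop atTop :=
  tendsto_log_atTop.comp tendsto_natCast_atTop_atTop

lemma tendsto_log_log_natCast : Tendsto (fun n : ℕ => log (log n)) atTop atTop :=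
  tendsto_log_atTop.comp tendsto_log_natCast

lemma tendsto_eps : Tendsto eps atTop (𝓝 0) :=
  (isLittleO_log_id_atTop.tendsto_div_nhds_zero).comp tendsto_log_natCast

lemma tendsto_log_div_natCast : Tendsto (fun n : ℕ => log n / n) atTop (𝓝 0) :=
  (isLittleO_log_id_atTop.tendsto_div_nhds_zero).comp tendsto_natCast_atTop_atTop

/-- The number of disjoint families into which in-edges are split. -/
noncomputable def numFamilies (n : ℕ) : ℕ := ⌊log n / 100⌋₊

lemma tendsto_numFamilies : Tendsto numFamilies atTop atTop :=
  tendsto_nat_floor_atTop.comp (tendsto_log_natCast.atTop_div_const (by norm_num))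

lemma numFamilies_le (n : ℕ) : (numFamilies n : ℝ) ≤ log n / 100 :=
  Nat.floor_le (div_nonneg (log_natCast_nonneg n) (by norm_num))

lemma le_numFamilies_add_one (n : ℕ) : log n / 100 ≤ numFamilies n + 1 :=
  (Nat.lt_floor_add_one _).le

lemma eventually_le_numColours : ∀ᶠ n in atTop,
    (1 + 40 * eps n) * n ≤ numColours n ∧ numColours n ≤ 2 * n := by
  filter_upwards [tendsto_eps.eventually_le_const (show (0 : ℝ) < 1 / 50 by norm_num),
    tendsto_log_log_natCast.eventually_ge_atTop 1, tendsto_log_natCast.eventually_ge_atTop 1,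
    tendsto_log_div_natCast.eventually_le_const (show (0 : ℝ) < 10 by norm_num),
    eventually_gt_atTop 0] with n h1 h2 h3 h4 h5
  have hn : (0 : ℝ) < n := by exact_mod_cast h5
  have h0 : 0 ≤ eps n := by unfold eps; positivity
  have h6 : 1 ≤ 10 * (eps n * n) := by
    rw [div_le_iff₀ hn] at h4
    have : 1 / log n ≤ eps n := by unfold eps; gcongr
    calc (1 : ℝ) = 1 / log n * log n := by field_simp
      _ ≤ eps n * (10 * n) := by gcongr
      _ = _ := by ring
  constructor
  · have := (Nat.lt_floor_add_one ((1 + 50 * eps n) * n)).le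
    unfold numColours
    nlinarith
  · have : (numColours n : ℝ) ≤ (1 + 50 * eps n) * n := Nat.floor_le (by positivity)
    have h7 : (numColours n : ℝ) ≤ (2 * n : ℕ) := by push_cast; nlinarith
    exact_mod_cast h7

lemma eventually_trapped {β : ℝ} (h0 : 0 < β) (h1 : β ≤ exp (-300) / 4) : ∀ᶠ n in atTop,
    n * numColours n * (4 * β) ^ numFamilies n ≤ β := by
  filter_upwards [eventually_le_numColours, eventually_gt_atTop 0,
    tendsto_natCast_atTop_atTop.eventually_ge_atTop (2 * exp 300 / β)] with n h2 h3 h4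
  have hn : (0 : ℝ) < n := by exact_mod_cast h3
  have hw : (numColours n : ℝ) ≤ 2 * n := by exact_mod_cast h2.2
  have h5 : (4 * β) ^ numFamilies n ≤ exp 300 / n ^ 3 := by
    calc (4 * β) ^ numFamilies n ≤ exp (-300) ^ numFamilies n := by gcongr; linarith
      _ = exp (-300 * numFamilies n) := by rw [← exp_nat_mul]; ring_nf
      _ ≤ exp (300 - (3 : ℕ) * log n) := by
          gcongr
          have := le_numFamilies_add_one n
          push_cast
          linarith
      _ = _ := by rw [exp_sub, exp_nat_mul, exp_log hn]
  calc n * numColours n * (4 * β) ^ numFamilies n ≤ n * (2 * n) * (exp 300 / n ^ 3) := by gcongr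
    _ = 2 * exp 300 / n := by field_simp
    _ ≤ β := by
      rw [div_le_iff₀ h0] at h4
      rw [div_le_iff₀ hn]
      linarith

lemma eventually_large {β : ℝ} (h0 : 0 < β) : ∀ᶠ n in atTop,
    (2 : ℝ) ^ n * 2 ^ numColours n * exp (-((numColours n - n : ℕ) / numColours n) *
      (numFamilies n * ⌊β ^ 3 / 9 * n⌋₊)) ≤ β := by
  have hβ : 0 < β ^ 3 := by positivity
  filter_upwards [eventually_le_numColours, eventually_gt_atTop 0,
    tendsto_natCast_atTop_atTop.eventually_ge_atTop (-log β),
    tendsto_natCast_atTop_atTop.eventually_ge_atTop (18 / β ^ 3),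
    tendsto_log_log_natCast.eventually_ge_atTop (720 / β ^ 3),
    tendsto_log_natCast.eventually_ge_atTop 200] with n h2 h3 h4 h5 h6 h7
  have hn : (0 : ℝ) < n := by exact_mod_cast h3
  have hL : 0 ≤ log (log n) := le_trans (by positivity) h6
  have hx : 0 < log n := by linarith
  have he : 0 ≤ eps n := by unfold eps; positivity
  have hw : (numColours n : ℝ) ≤ 2 * n := by exact_mod_cast h2.2
  have hle : (n : ℝ) ≤ numColours n := by nlinarith [h2.1]
  have hw0 : (0 : ℝ) < numColours n := hn.trans_le hle
  have hsub : ((numColours n - n : ℕ) : ℝ) = numColours n - n :=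
    Nat.cast_sub (by exact_mod_cast hle)
  have hratio : 20 * eps n ≤ (numColours n - n : ℕ) / numColours n := by
    rw [le_div_iff₀ hw0, hsub]
    calc 20 * eps n * numColours n ≤ 20 * eps n * (2 * n) := by gcongr
      _ ≤ _ := by linarith [h2.1]
  have hk : log n / 200 ≤ numFamilies n := by linarith [le_numFamilies_add_one n]
  have hfl : β ^ 3 / 18 * n ≤ ⌊β ^ 3 / 9 * n⌋₊ := by
    have := (Nat.lt_floor_add_one (β ^ 3 / 9 * n)).le
    rw [div_le_iff₀ hβ] at h5
    linarith
  have hexp : 4 * (n : ℝ) ≤ (numColours n - n : ℕ) / numColours n *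
      (numFamilies n * ⌊β ^ 3 / 9 * n⌋₊) := by
    rw [div_le_iff₀ hβ] at h6
    calc 4 * (n : ℝ) ≤ (log (log n) * β ^ 3) / 180 * n := by gcongr; linarith
      _ = 20 * eps n * (log n / 200 * (β ^ 3 / 18 * n)) := by unfold eps; field_simp; ring
      _ ≤ _ := by gcongr
  have h2e : (2 : ℝ) ≤ exp 1 := by linarith [add_one_le_exp (1 : ℝ)]
  calc _ ≤ exp 1 ^ n * exp 1 ^ numColours n * exp (-(4 * n)) := by
        gcongr
        linarith
    _ = exp (n + numColours n - 4 * n) := by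
        rw [← exp_nat_mul, ← exp_nat_mul, ← exp_add, ← exp_add]; ring_nf
    _ ≤ exp (log β) := by gcongr; linarith
    _ = β := exp_log h0

lemma eventually_admissible {β : ℝ} (h0 : 0 < β) (h1 : β ≤ exp (-300) / 4) : ∀ᶠ n in atTop,
    Admissible β n (numColours n) (numFamilies n) := by
  have hβ : β ≤ 1 / 100 := by
    have : exp (-300) ≤ 1 / 300 := by
      rw [exp_neg, inv_eq_one_div]
      gcongr
      linarith [add_one_le_exp (300 : ℝ)]
    linarith
  have hfew : Tendsto (fun n => 4 * (1 - β / 4) ^ numFamilies n) atTop (𝓝 0) := by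
    simpa using ((tendsto_pow_atTop_nhds_zero_of_lt_one (by linarith) (by linarith)).comp
      tendsto_numFamilies).const_mul (4 : ℝ)
  have hstuck : Tendsto (fun n => exp 1 * numFamilies n *
      exp (-(30 * β ^ 2 * numFamilies n))) atTop (𝓝 0) := by
    have hc : 0 < 30 * β ^ 2 := by positivity
    have h := (((tendsto_pow_mul_exp_neg_atTop_nhds_zero 1).comp
      ((tendsto_natCast_atTop_atTop.comp tendsto_numFamilies).const_mul_atTop hc)).const_mul
        (exp 1 / (30 * β ^ 2)))
    rw [mul_zero] at h
    refine h.congr fun n => ?_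
    simp only [Function.comp_apply, pow_one]
    field_simp
  filter_upwards [eventually_le_numColours, eventually_trapped h0 h1, eventually_large h0,
    hfew.eventually_le_const (show 0 < β ^ 2 by positivity), hstuck.eventually_le_const h0,
    tendsto_numFamilies.eventually_ge_atTop 1,
    tendsto_natCast_atTop_atTop.eventually_ge_atTop (4 / β),
    tendsto_log_log_natCast.eventually_ge_atTop 0, eventually_ge_atTop 4] with
    n hw ht hl hf hs hk hn hL h4
  have h4' : (4 : ℝ) ≤ n := by exact_mod_cast h4
  have he : 0 ≤ eps n := div_nonneg hL (log_natCast_nonneg n)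
  refine ⟨h0, hβ, ?_, ?_, hk, ?_, hw.2, hf, ht, hl, hs⟩
  · rw [div_le_iff₀ h0] at hn
    linarith
  · have : (n : ℝ) ≤ numColours n := by nlinarith [hw.1]
    exact_mod_cast this
  · have := numFamilies_le n
    have := log_le_self (show (0 : ℝ) ≤ n by positivity)
    linarith

/-- A time at which most vertices have large in-degree but some have in-degree zero. -/
noncomputable def earlyTime (n : ℕ) : ℕ := ⌊3 / 4 * (n * log n)⌋₊

lemma earlyTime_le (n : ℕ) : (earlyTime n : ℝ) ≤ 3 / 4 * (n * log n) :=
  Nat.floor_le (by have := log_natCast_nonneg n; positivity)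

lemma eventually_earlyTime_add_le : ∀ᶠ m in atTop,
    earlyTime (m + 1) + 2 * m ≤ (m + 1) * m := by
  filter_upwards [(tendsto_log_div_natCast.comp (tendsto_add_atTop_nat 1)).eventually_le_const
    (show (0 : ℝ) < 1 / 10 by norm_num), eventually_ge_atTop 4] with m h1 h2
  have h2' : (4 : ℝ) ≤ m := by exact_mod_cast h2
  have h3 := earlyTime_le (m + 1)
  simp only [Function.comp_apply, Nat.cast_add, Nat.cast_one] at h1 h3
  rw [div_le_iff₀ (by positivity)] at h1
  have h4 : (earlyTime (m + 1) : ℝ) + 2 * m ≤ (m + 1) * m := by nlinarith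
  exact_mod_cast h4

lemma eventually_exp_le_mul_pow : ∀ᶠ m : ℕ in atTop,
    exp (log (m + 1 : ℕ) / 10) ≤ (m + 1) * (1 - earlyTime (m + 1) / m ^ 2 : ℝ) ^ m := by
  filter_upwards [(tendsto_log_div_natCast.comp (tendsto_add_atTop_nat 1)).eventually_le_const
    (show (0 : ℝ) < 1 / 10 by norm_num), eventually_ge_atTop 20] with m h1 h2
  have hm : (20 : ℝ) ≤ m := by exact_mod_cast h2
  have hx := log_natCast_nonneg (m + 1)
  have h3 := earlyTime_le (m + 1)
  simp only [Function.comp_apply] at h1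
  have hn : ((m + 1 : ℕ) : ℝ) ≤ 21 / 20 * m := by push_cast; linarith
  have hn0 : (0 : ℝ) < (m + 1 : ℕ) := by positivity
  rw [div_le_iff₀ hn0] at h1
  have hy0 : (0 : ℝ) ≤ earlyTime (m + 1) / m ^ 2 := by positivity
  have hmy : m * (earlyTime (m + 1) / m ^ 2 : ℝ) ≤ 63 / 80 * log (m + 1 : ℕ) := by
    have h4 : m * (earlyTime (m + 1) / m ^ 2 : ℝ) = earlyTime (m + 1) / m := by field_simp
    rw [h4, div_le_iff₀ (by positivity)]
    nlinarith
  have hy : (earlyTime (m + 1) / m ^ 2 : ℝ) ≤ 1 / 10 := by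
    by_contra! hc
    nlinarith
  set y : ℝ := earlyTime (m + 1) / m ^ 2
  have hlog : -(10 / 9 * y) ≤ log (1 - y) := by
    refine le_trans ?_ (one_sub_inv_le_log_of_pos (by linarith))
    have h5 : (1 - y)⁻¹ ≤ 1 + 10 / 9 * y := by
      rw [inv_le_iff_one_le_mul₀ (by linarith)]
      nlinarith
    linarith
  have hpow : exp (-(9 / 10 * log (m + 1 : ℕ))) ≤ (1 - y) ^ m := by
    rw [← exp_log (show 0 < (1 - y) ^ m from pow_pos (by linarith) _), log_pow]
    gcongr
    nlinarith
  calc exp (log (m + 1 : ℕ) / 10)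
      = exp (log (m + 1 : ℕ)) * exp (-(9 / 10 * log (m + 1 : ℕ))) := by
        rw [← exp_add]; ring_nf
    _ ≤ _ := by rw [exp_log hn0]; push_cast at hpow ⊢; gcongr

lemma tendsto_many_small_inDegree {β : ℝ} (hβ : 0 < β) :
    Tendsto (fun n : ℕ => n * (exp (6 * numFamilies n) * exp (-(4 / 5 * (earlyTime n / n)))) /
      √(β * n)) atTop (𝓝 0) := by
  have h : Tendsto (fun n : ℕ => exp (4 / 5) / √β * exp (-(log n / 25))) atTop (𝓝 0) := by
    simpa using (tendsto_exp_neg_atTop_nhds_zero.comp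
      (tendsto_log_natCast.atTop_div_const (show (0 : ℝ) < 25 by norm_num))).const_mul
        (exp (4 / 5) / √β)
  refine squeeze_zero' (Eventually.of_forall fun n => by positivity) ?_ h
  filter_upwards [eventually_ge_atTop 1] with n hn
  have hn1 : (1 : ℝ) ≤ n := by exact_mod_cast hn
  have hn0 : (0 : ℝ) < n := by linarith
  have hβ' : 0 < √β := sqrt_pos.2 hβ
  have hk := numFamilies_le n
  have hM : 3 / 4 * log n - 1 ≤ earlyTime n / n := by
    have := (Nat.lt_floor_add_one (3 / 4 * (n * log n))).le
    rw [le_div_iff₀ hn0]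
    unfold earlyTime
    nlinarith
  have hsq : √(n : ℝ) = exp (log n / 2) := by
    rw [exp_half, exp_log hn0]
  rw [sqrt_mul hβ.le, hsq, div_le_iff₀ (by positivity)]
  calc n * (exp (6 * numFamilies n) * exp (-(4 / 5 * (earlyTime n / n))))
      = exp (log n + 6 * numFamilies n - 4 / 5 * (earlyTime n / n)) := by
        conv_lhs => rw [← exp_log hn0]
        rw [← exp_add, ← exp_add, exp_log hn0]
        ring_nf
    _ ≤ exp (4 / 5 - log n / 25 + log n / 2) := by gcongr; linarith
    _ = exp (4 / 5) / √β * exp (-(log n / 25)) * (√β * exp (log n / 2)) := by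
        rw [exp_add, sub_eq_add_neg, exp_add]
        field_simp

lemma tendsto_prob_not_fewSmall {β : ℝ} (h0 : 0 < β) (h1 : β ≤ exp (-300) / 4) :
    Tendsto (fun m => prob fun ω : SampleSpace (m + 1) =>
      ¬ FewSmall β (numFamilies (m + 1)) ω) atTop (𝓝 0) := by
  have hμ : Tendsto (fun m : ℕ => exp (log (m + 1 : ℕ) / 10)) atTop atTop :=
    tendsto_exp_atTop.comp ((tendsto_log_natCast.comp (tendsto_add_atTop_nat 1)).atTop_div_const
      (by norm_num))
  have h := (hμ.const_div_atTop 4).add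
    ((tendsto_many_small_inDegree h0).comp (tendsto_add_atTop_nat 1))
  rw [add_zero] at h
  refine squeeze_zero' (Eventually.of_forall fun m => prob_nonneg _) ?_ h
  filter_upwards [eventually_earlyTime_add_le, eventually_exp_le_mul_pow,
    hμ.eventually_ge_atTop 2, (tendsto_add_atTop_nat 1).eventually
      (eventually_admissible h0 h1)] with m hM hp h2 ha
  have : Nonempty (Colour (m + 1)) := ⟨⟨0, (Nat.succ_pos m).trans_le ha.le_w⟩⟩
  have h3 := prob_not_fewSmall_le h0 (k := numFamilies (m + 1)) hM h2 hp
  simp only [Function.comp_apply]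
  push_cast at h3 ⊢
  exact h3

lemma eventually_prob_good_ge {δ : ℝ} (hδ : 0 < δ) : ∀ᶠ m in atTop,
    1 - δ ≤ prob fun ω : SampleSpace (m + 1) =>
      REvent ω (hitTime (m + 1) (ZEvent ω)) := by
  set β := min (exp (-300) / 4) (δ / 210)
  have h0 : 0 < β := lt_min (by positivity) (by positivity)
  have h1 : β ≤ exp (-300) / 4 := min_le_left _ _
  have h2 : β ≤ δ / 210 := min_le_right _ _
  filter_upwards [(tendsto_prob_not_fewSmall h0 h1).eventually_le_const
      (show 0 < δ / 2 by positivity),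
    (tendsto_add_atTop_nat 1).eventually (eventually_admissible h0 h1),
    (tendsto_log_div_natCast.comp (tendsto_add_atTop_nat 1)).eventually_le_const
      (show (0 : ℝ) < 1 by norm_num), eventually_ge_atTop 3] with m hf ha hl hm
  have : Nonempty (Colour (m + 1)) := ⟨⟨0, (Nat.succ_pos m).trans_le ha.le_w⟩⟩
  have hk : 3 * numFamilies (m + 1) + 1 ≤ m := by
    have h3 := numFamilies_le (m + 1)
    simp only [Function.comp_apply] at hl
    rw [div_le_one (by positivity)] at hl
    have hm' : (3 : ℝ) ≤ m := by exact_mod_cast hm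
    have h4 : 3 * (numFamilies (m + 1) : ℝ) + 1 ≤ m := by push_cast at h3 hl ⊢; linarith
    exact_mod_cast h4
  have h3 := prob_not_rEvent_le ha hk
  have h4 : prob (fun ω : SampleSpace (m + 1) => ¬ REvent ω (hitTime (m + 1) (ZEvent ω))) ≤
      prob (fun ω : SampleSpace (m + 1) => ¬ FewSmall β (numFamilies (m + 1)) ω) +
        prob (fun ω : SampleSpace (m + 1) => FewSmall β (numFamilies (m + 1)) ω ∧
          ¬ REvent ω (hitTime (m + 1) (ZEvent ω))) :=
    (prob_mono fun ω hω => or_iff_not_imp_left.2 fun h => ⟨not_not.1 h, hω⟩).trans (prob_or_le _ _)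
  rw [prob_not] at h4
  linarith

end Asymptotics

/-- A.a.s. `m_R = m_A = m_Z`: the hitting time for having a rainbow
spanning arborescence coincides with the hitting time for having a spanning
arborescence and with the hitting time for having at most one vertex of in-degree
zero. -/
theorem rainbow_arborescence_hitting_times :
    Tendsto
      (fun n : ℕ => prob (fun ω : SampleSpace n =>
        hitTime n (REvent ω) = hitTime n (AEvent ω) ∧
        hitTime n (AEvent ω) = hitTime n (ZEvent ω)))
      atTop (nhds 1) := by
  rw [← tendsto_add_atTop_iff_nat 1]
  refine tendsto_order.2 ⟨fun a ha => ?_, fun a ha => Eventually.of_forall fun m =>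
    (prob_le_one _).trans_lt ha⟩
  filter_upwards [eventually_prob_good_ge (show 0 < (1 - a) / 2 by linarith)] with m hm
  have h := prob_mono fun (ω : SampleSpace (m + 1)) h => hitTimes_eq_of_rEvent (ω := ω) h
  linarith
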